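/- arXiv:2307.02876 — 9 statements merged into one kernel-verified Lean document; each statement's English description precedes it below -/
import Mathlib

section
/- Let k ≥ 3 be an integer, let d ∈ (0,1), and set t = ⌈d^{−2(k−1)}⌉ + 1. For every ε > 0 there exists n_0 such that every k-uniform hypergraph H on n ≥ n_0 vertices with minimum codegree δ(H) ≥ (d+ε)n contains a copy of Z_{2r}^{(k)} for some r ∈ {1, …, t}. In other words, the codegree Turán density of the family {Z_2^{(k)}, Z_4^{(k)}, …, Z_{2t}^{(k)}} is at most d. -/
open Finset

open scoped Classical

/-- The degree of a set of vertices `s` in the edge set `E`: the number of edges containing `s`. -/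
noncomputable def hdeg {α : Type*} [DecidableEq α] (E : Finset (Finset α)) (s : Finset α) : ℕ :=
  (E.filter fun e => s ⊆ e).card

/-- The hypergraph with edge set `F` (on vertex type `α`) has a copy inside the hypergraph with
edge set `E` (on vertex type `β`). -/
def HasCopy {α β : Type*} [DecidableEq β] (F : Finset (Finset α)) (E : Finset (Finset β)) :
    Prop :=
  ∃ f : α → β, Function.Injective f ∧ ∀ e ∈ F, e.image f ∈ E

/-- The codegree Turán number `exco k n F`: the largest `d` such that some `F`-free `k`-uniform
hypergraph on `n` vertices has minimum codegree at least `d`. -/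
noncomputable def exco {α : Type*} (k n : ℕ) (F : Finset (Finset α)) : ℕ :=
  sSup {d : ℕ | ∃ E : Finset (Finset (Fin n)), (∀ e ∈ E, e.card = k) ∧ ¬ HasCopy F E ∧
    ∀ s : Finset (Fin n), s.card = k - 1 → d ≤ hdeg E s}

/-- The codegree Turán density `γ(F)`. -/
noncomputable def codegTuranDensity {α : Type*} (k : ℕ) (F : Finset (Finset α)) : ℝ :=
  Filter.limsup (fun n : ℕ => (exco k n F : ℝ) / n) Filter.atTop

/-- The `k`-uniform zycle of length `ℓ`: vertices are pairs `(i, j)` with `i ∈ Fin ℓ`,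
`j ∈ Fin (k-1)`; for each `i, j` there is an edge `{(i, 1), …, (i, k-1), (i+1, j)}`
(first coordinate taken modulo `ℓ`). -/
def zycle (k ℓ : ℕ) : Finset (Finset (Fin ℓ × Fin (k - 1))) :=
  Finset.univ.image fun p : Fin ℓ × Fin (k - 1) =>
    insert (⟨(p.1.val + 1) % ℓ, Nat.mod_lt _ p.1.pos⟩, p.2)
      (Finset.univ.image fun j : Fin (k - 1) => (p.1, j))

/-- `e ▷ f` : every extension of `e` by a vertex of `f` is an edge. -/
def Tri {α : Type*} [DecidableEq α] (E : Finset (Finset α)) (e f : Finset α) : Prop :=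
  ∀ v ∈ f, insert v e ∈ E

/-- If a finset is larger than the number of elements conflicting with a given finite family,
it has an element in conflict with no member of the family. -/
theorem exists_not_conflict {β : Type*} [Fintype β] {C : β → β → Prop} {c : ℕ}
    (hc : ∀ v, #{y | C v y} ≤ c) (S X : Finset β) (h : #X * c < #S) :
    ∃ u ∈ S, ∀ x ∈ X, ¬ C x u := by
  by_contra! hcon
  have hsub : S ⊆ X.biUnion fun x => {y | C x y} := by
    intro u hu
    obtain ⟨x, hx, hxu⟩ := hcon u hu
    simp only [mem_biUnion, mem_filter, mem_univ, true_and]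
    exact ⟨x, hx, hxu⟩
  have h1 := card_le_card hsub
  have h2 := card_biUnion_le_card_mul X (fun x => ({y | C x y} : Finset β)) c fun x _ => hc x
  omega

/-- `x 0, …, x (p - 1)` is a directed cycle of `A` inside `V` whose vertices are pairwise not
in the relation `C`. -/
def IsFreeCycle {β : Type*} (C : β → β → Prop) (V : Finset β) (A : β → β → Prop)
    (p : ℕ) (x : ℕ → β) : Prop :=
  (∀ i < p, x i ∈ V) ∧ (∀ i < p, A (x i) (x ((i + 1) % p))) ∧
    ∀ i < p, ∀ j < p, i ≠ j → ¬ C (x i) (x j)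

/-- Closing a path `y 0, …, y (q - 1)` into a cycle with two further vertices `u` and `v`. -/
theorem IsFreeCycle.of_path {β : Type*} {C : β → β → Prop} {V : Finset β} {A : β → β → Prop}
    (hsymm : ∀ x y, C x y → C y x) {q : ℕ} (hq : 1 ≤ q) {y : ℕ → β} {u v : β}
    (hyV : ∀ i < q, y i ∈ V) (hu : u ∈ V) (hv : v ∈ V)
    (hyA : ∀ i, i + 1 < q → A (y i) (y (i + 1)))
    (hyC : ∀ i < q, ∀ j < q, i ≠ j → ¬ C (y i) (y j))
    (hlast : A (y (q - 1)) u) (huv : A u v) (hvy : A v (y 0))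
    (hCu : ∀ i < q, ¬ C (y i) u) (hCv : ∀ i < q, ¬ C (y i) v) (hCuv : ¬ C u v) :
    IsFreeCycle C V A (q + 2) fun i => if i < q then y i else if i = q then u else v := by
  refine ⟨?_, ?_, ?_⟩
  · intro i _
    dsimp only
    split_ifs with h1 h2
    exacts [hyV i h1, hu, hv]
  · intro i hi
    dsimp only
    rcases lt_trichotomy i q with h | rfl | h
    · rw [Nat.mod_eq_of_lt (by omega), if_pos h]
      by_cases h' : i + 1 < q
      · rw [if_pos h']
        exact hyA i h'
      · rw [if_neg h', if_pos (by omega)]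
        obtain rfl : i = q - 1 := by omega
        exact hlast
    · rw [Nat.mod_eq_of_lt (by omega), if_neg (lt_irrefl _), if_pos rfl, if_neg (by omega),
        if_neg (by omega)]
      exact huv
    · obtain rfl : i = q + 1 := by omega
      rw [if_neg (by omega), if_neg (by omega), Nat.mod_self, if_pos (by omega)]
      exact hvy
  · intro i hi j hj hij
    dsimp only
    split_ifs with h1 h2 h3 h4 h5 h6 h7 h8
    · exact hyC i h1 j h2 hij
    · exact hCu i h1
    · exact hCv i h1
    · exact fun h => hCu j h5 (hsymm _ _ h)
    · omega
    · exact hCuv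
    · exact fun h => hCv j h7 (hsymm _ _ h)
    · exact fun h => hCuv (hsymm _ _ h)
    · omega

/-- If every vertex that is not `rich` keeps its edges, then a cycle of the digraph in which
the out-neighbourhood of `v` is added to every rich vertex either is a cycle of `A`, or contains
a path of `A` that starts in the out-neighbourhood of `v` and ends in a rich vertex. -/
theorem IsFreeCycle.cycle_or_path {β : Type*} {C : β → β → Prop} {V : Finset β}
    {A : β → β → Prop} {rich : β → Prop} {v : β} {p : ℕ} {x : ℕ → β}
    (h : IsFreeCycle C V (fun a b => A a b ∨ rich a ∧ A v b) p x) :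
    IsFreeCycle C V A p x ∨
      ∃ (q : ℕ) (y : ℕ → β), 1 ≤ q ∧ q ≤ p ∧ (∀ i < q, y i ∈ V) ∧
        (∀ i, i + 1 < q → A (y i) (y (i + 1))) ∧
        (∀ i < q, ∀ j < q, i ≠ j → ¬ C (y i) (y j)) ∧ A v (y 0) ∧ rich (y (q - 1)) := by
  obtain ⟨hV, hA, hC⟩ := h
  by_cases hall : ∀ i < p, A (x i) (x ((i + 1) % p))
  · exact Or.inl ⟨hV, hall, hC⟩
  right
  push Not at hall
  obtain ⟨i₀, hi₀, hnot⟩ := hall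
  obtain ⟨hrich, hv⟩ := (hA i₀ hi₀).resolve_left hnot
  have hp : 0 < p := by omega
  have hex : ∃ q, 1 ≤ q ∧ rich (x ((i₀ + q) % p)) :=
    ⟨p, hp, by rwa [Nat.add_mod_right, Nat.mod_eq_of_lt hi₀]⟩
  have hle : Nat.find hex ≤ p :=
    Nat.find_min' hex ⟨hp, by rwa [Nat.add_mod_right, Nat.mod_eq_of_lt hi₀]⟩
  have hspec := Nat.find_spec hex
  refine ⟨Nat.find hex, fun i => x ((i₀ + 1 + i) % p), hspec.1, hle,
    fun i _ => hV _ (Nat.mod_lt _ hp), ?_, ?_, hv, ?_⟩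
  · intro i hi
    have h1 := hA ((i₀ + 1 + i) % p) (Nat.mod_lt _ hp)
    rw [Nat.mod_add_mod] at h1
    refine h1.resolve_right fun h2 => Nat.find_min hex hi ⟨by omega, ?_⟩
    rw [show i₀ + (i + 1) = i₀ + 1 + i by ring]
    exact h2.1
  · intro i hi j hj hij
    refine hC _ (Nat.mod_lt _ hp) _ (Nat.mod_lt _ hp) fun heq => hij ?_
    have h1 : i ≡ j [MOD p] := Nat.ModEq.add_left_cancel' (i₀ + 1) heq
    exact Nat.ModEq.eq_of_lt_of_lt h1 (by omega) (by omega)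
  · have : i₀ + 1 + (Nat.find hex - 1) = i₀ + Nat.find hex := by omega
    dsimp only
    rw [this]
    exact hspec.2

/-- Some vertex of a finite digraph has in-degree at least the minimum out-degree. -/
theorem exists_le_inDegree {β : Type*} {V : Finset β} (hV : V.Nonempty) {A : β → β → Prop}
    {δ : ℕ} (h : ∀ x ∈ V, δ ≤ #{y ∈ V | A x y}) : ∃ v ∈ V, δ ≤ #{x ∈ V | A x v} := by
  by_contra! hcon
  have h1 : ∑ x ∈ V, #{y ∈ V | A x y} = ∑ y ∈ V, #{x ∈ V | A x y} :=
    sum_card_bipartiteAbove_eq_sum_card_bipartiteBelow A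
  have h2 : ∑ y ∈ V, #{x ∈ V | A x y} < ∑ _y ∈ V, δ := sum_lt_sum_of_nonempty hV hcon
  have h3 : ∑ _x ∈ V, δ ≤ ∑ x ∈ V, #{y ∈ V | A x y} := sum_le_sum h
  omega

/-- A robust form of the Chvátal–Szemerédi bound on the girth of a digraph with large minimum
out-degree: the vertices of the short cycle can be chosen free of conflicts. -/
theorem exists_isFreeCycle {β : Type*} [Fintype β] {C : β → β → Prop}
    (hsymm : ∀ x y, C x y → C y x) {c T ρ : ℕ}
    (hc : ∀ v, #{y | C v y} ≤ c) (hρ : 0 < ρ) (m : ℕ) (hT : (2 * m + 1) * c ≤ T)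
    (V : Finset β) (hVne : V.Nonempty) (A : β → β → Prop) (hcard : #V < (m + 1) * ρ)
    (hout : ∀ x ∈ V, ρ + m * (T + c) ≤ #{y ∈ V | A x y}) :
    ∃ p x, 1 ≤ p ∧ p ≤ 2 * m ∧ IsFreeCycle C V A p x := by
  induction m generalizing V A with
  | zero =>
    obtain ⟨v, hv⟩ := hVne
    have h1 := hout v hv
    have h2 : #{y ∈ V | A v y} ≤ #V := card_filter_le _ _
    omega
  | succ m ih =>
    obtain ⟨v, hvV, hin⟩ := exists_le_inDegree hVne hout
    have hTc : (2 * m + 1) * c ≤ T := by nlinarith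
    have hT1 : c ≤ T := by nlinarith
    have hms : ρ + (m + 1) * (T + c) = ρ + m * (T + c) + (T + c) := by ring
    rw [hms] at hin hout
    by_cases h2 : c < #{w ∈ V | A v w ∧ A w v}
    · obtain ⟨w, hw, hwC⟩ := exists_not_conflict hc {w ∈ V | A v w ∧ A w v} {v} (by simpa using h2)
      simp only [mem_filter] at hw
      have hvw : ¬ C v w := hwC v (mem_singleton_self v)
      refine ⟨2, fun i => if i = 0 then v else w, by omega, by omega, ?_, ?_, ?_⟩
      · intro i _
        dsimp only
        split_ifs
        exacts [hvV, hw.1]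
      · intro i hi
        interval_cases i
        · simpa using hw.2.1
        · simpa using hw.2.2
      · intro i hi j hj hij
        interval_cases i <;> interval_cases j
        · exact absurd rfl hij
        · simpa using hvw
        · simpa using fun h => hvw (hsymm _ _ h)
        · exact absurd rfl hij
    push Not at h2
    have hconf : ∀ W : Finset β, #{y ∈ W | C v y} ≤ c := fun W =>
      (card_le_card (filter_subset_filter _ (subset_univ W))).trans (hc v)
    set V' : Finset β := {y ∈ V | ¬ A y v ∧ ¬ C v y} with hV'
    have hV'V : V' ⊆ V := filter_subset _ _
    have hloss : ∀ P : β → Prop,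
        #{y ∈ V | P y} ≤ #{y ∈ V' | P y} + #{y ∈ V | P y ∧ A y v} + #{y ∈ V | C v y} := by
      intro P
      refine (card_le_card (t := ({y ∈ V' | P y} ∪ {y ∈ V | P y ∧ A y v}) ∪ {y ∈ V | C v y})
        ?_).trans ((card_union_le _ _).trans (by gcongr; exact card_union_le _ _))
      intro y hy
      simp only [hV', mem_union, mem_filter] at hy ⊢
      tauto
    have hvout : ρ + m * (T + c) ≤ #{y ∈ V' | A v y} := by
      have h3 := hloss (A v)
      have h4 := hout v hvV
      have h5 := hconf V
      omega
    set rich : β → Prop := fun x => T < #{y ∈ V | A x y ∧ A y v} with hrich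
    obtain ⟨p, x, hp1, hp2, hcyc⟩ := ih hTc V' (by
        have : (#{y ∈ V' | A v y}) ≠ 0 := by omega
        obtain ⟨y, hy⟩ := card_ne_zero.1 this
        exact ⟨y, (mem_filter.1 hy).1⟩) (fun a b => A a b ∨ rich a ∧ A v b) (by
        have h6 : Disjoint V' {y ∈ V | A y v} := by
          rw [disjoint_left]
          intro y hy hy'
          exact (mem_filter.1 hy).2.1 (mem_filter.1 hy').2
        have h7 := card_le_card (union_subset hV'V (filter_subset (fun y => A y v) V))
        rw [card_union_of_disjoint h6] at h7
        have h8 : (m + 1 + 1) * ρ = (m + 1) * ρ + ρ := by ring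
        omega) (by
        intro a ha
        by_cases hr : rich a
        · refine hvout.trans (card_le_card fun y hy => ?_)
          simp only [mem_filter] at hy ⊢
          exact ⟨hy.1, Or.inr ⟨hr, hy.2⟩⟩
        · have h3 := hloss (A a)
          have h4 := hout a (hV'V ha)
          have h5 := hconf V
          have h6 : #{y ∈ V | A a y ∧ A y v} ≤ T := not_lt.1 hr
          have h7 : ρ + m * (T + c) ≤ #{y ∈ V' | A a y} := by omega
          refine h7.trans (card_le_card fun y hy => ?_)
          simp only [mem_filter] at hy ⊢
          exact ⟨hy.1, Or.inl hy.2⟩)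
    rcases hcyc.cycle_or_path with h | ⟨q, y, hq1, hqp, hyV, hyA, hyC, hvy, hyr⟩
    · exact ⟨p, x, hp1, by omega, fun i hi => hV'V (h.1 i hi), h.2⟩
    · obtain ⟨u, hu, huC⟩ := exists_not_conflict hc {w ∈ V | A (y (q - 1)) w ∧ A w v}
        (insert v ((range q).image y)) (by
          have h3 : #(insert v ((range q).image y)) ≤ 2 * m + 1 := by
            have h4 := card_insert_le v ((range q).image y)
            have h5 : #((range q).image y) ≤ q := card_image_le.trans (card_range q).le
            omega
          have h6 : T < #{w ∈ V | A (y (q - 1)) w ∧ A w v} := hyr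
          exact ((Nat.mul_le_mul_right c h3).trans hTc).trans_lt h6)
      simp only [mem_filter] at hu
      refine ⟨q + 2, _, by omega, by omega, IsFreeCycle.of_path hsymm hq1
        (fun i hi => hV'V (hyV i hi)) hu.1 hvV hyA hyC hu.2.1 hu.2.2 hvy ?_ ?_ ?_⟩
      · intro i hi
        exact huC _ (mem_insert_of_mem (mem_image_of_mem _ (mem_range.2 hi)))
      · intro i hi h
        exact (mem_filter.1 (hyV i hi)).2.2 (hsymm _ _ h)
      · intro h
        exact huC v (mem_insert_self _ _) (hsymm _ _ h)

/-- Greedy choice of conflict-free representatives from large finsets. -/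
theorem exists_conflict_free_choice {β : Type*} [Fintype β] [Nonempty β] {C : β → β → Prop}
    (hsymm : ∀ x y, C x y → C y x) {c : ℕ} (hc : ∀ v, #{y | C v y} ≤ c) (X : Finset β)
    (S : ℕ → Finset β) (p : ℕ) (hS : ∀ i < p, (#X + p) * c < #(S i)) :
    ∃ g : ℕ → β, ∀ i < p, g i ∈ S i ∧ (∀ x ∈ X, ¬ C x (g i)) ∧
      ∀ j < p, i ≠ j → ¬ C (g i) (g j) := by
  have key : ∀ r ≤ p, ∃ g : ℕ → β, ∀ i < r, g i ∈ S i ∧ (∀ x ∈ X, ¬ C x (g i)) ∧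
      ∀ j < r, i ≠ j → ¬ C (g i) (g j) := by
    intro r
    induction r with
    | zero => exact fun _ => ⟨fun _ => Classical.arbitrary β, by simp⟩
    | succ r ih =>
      intro hr
      obtain ⟨g, hg⟩ := ih (by omega)
      obtain ⟨u, hu, huC⟩ := exists_not_conflict hc (S r) (X ∪ (range r).image g) (by
        refine lt_of_le_of_lt (Nat.mul_le_mul_right c ?_) (hS r hr)
        have h5 : #((range r).image g) ≤ r := card_image_le.trans (card_range r).le
        have := card_union_le X ((range r).image g)
        omega)
      have hug : ∀ i < r, ¬ C (g i) u := fun i hi =>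
        huC _ (mem_union_right _ (mem_image_of_mem _ (mem_range.2 hi)))
      refine ⟨fun i => if i < r then g i else u, fun i hi => ?_⟩
      dsimp only
      by_cases h1 : i < r
      · rw [if_pos h1]
        refine ⟨(hg i h1).1, (hg i h1).2.1, fun j hj hij => ?_⟩
        split_ifs with h2
        · exact (hg i h1).2.2 j h2 hij
        · exact hug i h1
      · rw [if_neg h1]
        obtain rfl : i = r := by omega
        refine ⟨hu, fun x hx => huC x (mem_union_left _ hx), fun j hj hij => ?_⟩
        rw [if_pos (by omega)]
        exact fun h => hug j (by omega) (hsymm _ _ h)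
  exact key p le_rfl

/-- There are more than `T` paths of length two in `A` from `x` to `y` with middle vertex
in `V`. -/
def ManyTwoStep {β : Type*} (V : Finset β) (A : β → β → Prop) (T : ℕ) (x y : β) : Prop :=
  T < #{f ∈ V | A x f ∧ A f y}

/-- The digraph of pairs joined by many paths of length two has almost the same minimum
out-degree as the original one. -/
theorem le_outDegree_two_step {β : Type*} {V : Finset β} {A : β → β → Prop} {D : ℝ} {T : ℕ}
    (hD : 0 < D) (hout : ∀ x ∈ V, D ≤ (#{y ∈ V | A x y} : ℝ)) {x : β} (hx : x ∈ V) :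
    D - #V * T / D ≤ (#{y ∈ V | ManyTwoStep V A T x y} : ℝ) := by
  set O : Finset β := {y ∈ V | A x y} with hO
  set R : Finset β := {y ∈ V | ManyTwoStep V A T x y} with hR
  have hOD : D ≤ (#O : ℝ) := hout x hx
  have h1 : ∑ f ∈ O, #{y ∈ V | A f y} = ∑ y ∈ V, #{f ∈ O | A f y} :=
    sum_card_bipartiteAbove_eq_sum_card_bipartiteBelow A
  have h2 : (#O : ℝ) * D ≤ ∑ f ∈ O, (#{y ∈ V | A f y} : ℝ) := by
    rw [← nsmul_eq_mul]
    exact card_nsmul_le_sum _ _ _ fun f hf => hout f (mem_filter.1 hf).1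
  have h3 : ∑ y ∈ V, #{f ∈ O | A f y} ≤ #R * #O + #V * T := by
    have h4 : ∀ y ∈ V, #{f ∈ O | A f y} ≤
        (if ManyTwoStep V A T x y then #O else 0) + T := by
      intro y _
      split_ifs with h5
      · exact (card_filter_le _ _).trans (Nat.le_add_right _ _)
      · rw [hO, filter_filter]
        have h6 : #{f ∈ V | A x f ∧ A f y} ≤ T := not_lt.1 h5
        omega
    refine (sum_le_sum h4).trans ?_
    rw [sum_add_distrib, ← sum_filter, sum_const, sum_const, smul_eq_mul, smul_eq_mul]
  have h5 : (#O : ℝ) * D ≤ #R * #O + #V * T := by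
    refine h2.trans ?_
    exact_mod_cast h1.trans_le h3
  have hOpos : (0 : ℝ) < #O := hD.trans_le hOD
  have h6 : D - #V * T / #O ≤ (#R : ℝ) := by
    rw [sub_le_iff_le_add, ← sub_le_iff_le_add', le_div_iff₀ hOpos]
    linarith
  have h7 : (#V * T : ℝ) / #O ≤ #V * T / D := by gcongr
  linarith

/-- Doubling the length: a cycle of the two-step digraph yields a cycle of even length. -/
theorem IsFreeCycle.double {β : Type*} [Fintype β] {C : β → β → Prop}
    (hsymm : ∀ x y, C x y → C y x) {c : ℕ} (hc : ∀ v, #{y | C v y} ≤ c)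
    {V : Finset β} {A : β → β → Prop} {p T : ℕ} {x : ℕ → β} (hT : 2 * p * c ≤ T)
    (h : IsFreeCycle C V (ManyTwoStep V A T) p x) :
    ∃ y, IsFreeCycle C V A (2 * p) y := by
  obtain ⟨hV, hA, hC⟩ := h
  have : Nonempty β := ⟨x 0⟩
  obtain ⟨g, hg⟩ := exists_conflict_free_choice hsymm hc ((range p).image x)
    (fun i => {f ∈ V | A (x i) f ∧ A f (x ((i + 1) % p))}) p (by
      intro i hi
      refine lt_of_le_of_lt ?_ (hA i hi)
      refine le_trans (Nat.mul_le_mul_right c ?_) hT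
      have : #((range p).image x) ≤ p := card_image_le.trans (card_range p).le
      omega)
  have hxg : ∀ i < p, ∀ j < p, ¬ C (x i) (g j) := fun i hi j hj =>
    (hg j hj).2.1 _ (mem_image_of_mem _ (mem_range.2 hi))
  refine ⟨fun i => if i % 2 = 0 then x (i / 2) else g (i / 2), ?_, ?_, ?_⟩
  · intro i hi
    dsimp only
    split_ifs
    · exact hV _ (by omega)
    · exact (mem_filter.1 (hg (i / 2) (by omega)).1).1
  · intro i hi
    have h1 := (mem_filter.1 (hg (i / 2) (by omega)).1).2
    dsimp only
    by_cases hpar : i % 2 = 0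
    · have h2 : (i + 1) % (2 * p) = i + 1 := Nat.mod_eq_of_lt (by omega)
      rw [if_pos hpar, h2, if_neg (by omega), show (i + 1) / 2 = i / 2 by omega]
      exact h1.1
    · have h2 : (i + 1) % (2 * p) = 2 * ((i / 2 + 1) % p) := by
        rw [← Nat.mul_mod_mul_left]
        congr 1
        omega
      rw [if_neg hpar, h2, if_pos (by omega), Nat.mul_div_cancel_left _ (by omega)]
      exact h1.2
  · intro i hi j hj hij
    dsimp only
    split_ifs with h1 h2 h2
    · exact hC _ (by omega) _ (by omega) (by omega)
    · exact hxg _ (by omega) _ (by omega)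
    · exact fun h => hxg _ (by omega) _ (by omega) (hsymm _ _ h)
    · exact (hg _ (by omega)).2.2 _ (by omega) (by omega)

/-- A set of functions determined by their values away from `j` is small. -/
theorem card_le_of_determined {q n : ℕ} (j : Fin q) (S : Finset (Fin q → Fin n))
    (hS : ∀ y ∈ S, ∀ z ∈ S, (∀ i, i ≠ j → y i = z i) → y = z) : #S ≤ n ^ (q - 1) := by
  have h : #S ≤ #(univ : Finset ({i // i ≠ j} → Fin n)) :=
    card_le_card_of_injOn (fun y i => y i) (fun _ _ => mem_univ _) fun y hy z hz hyz =>
      hS y hy z hz fun i hi => congrFun hyz ⟨i, hi⟩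
  simpa [Fintype.card_subtype_compl] using h

/-- Union bound over pairs of indices. -/
theorem card_le_sq_mul_of_pairs {q N : ℕ} {β : Type*} (S : Finset β)
    (P : Fin q × Fin q → Finset β) (hP : ∀ p, #(P p) ≤ N) (hS : ∀ y ∈ S, ∃ p, y ∈ P p) :
    #S ≤ q ^ 2 * N := by
  have h1 : S ⊆ univ.biUnion P := fun y hy => by simpa using hS y hy
  have h2 := card_biUnion_le_card_mul univ P N fun p _ => hP p
  have h3 := (card_le_card h1).trans h2
  simpa [sq] using h3

/-- Two tuples have an entry in common. -/
def TuplesMeet {q n : ℕ} (x y : Fin q → Fin n) : Prop :=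
  ∃ i j, x i = y j

theorem card_filter_tuplesMeet_le {q n : ℕ} (x : Fin q → Fin n) :
    #{y : Fin q → Fin n | TuplesMeet x y} ≤ q ^ 2 * n ^ (q - 1) := by
  refine card_le_sq_mul_of_pairs _ (fun p => {y | x p.1 = y p.2}) (fun p => ?_) fun y hy => ?_
  · refine card_le_of_determined p.2 _ fun y hy z hz h => funext fun i => ?_
    by_cases hi : i = p.2
    · rw [hi, ← (mem_filter.1 hy).2, ← (mem_filter.1 hz).2]
    · exact h i hi
  · obtain ⟨i, j, hij⟩ := (mem_filter.1 hy).2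
    exact ⟨(i, j), by simpa using hij⟩

theorem card_filter_not_injective_le (q n : ℕ) :
    #{y : Fin q → Fin n | ¬ Function.Injective y} ≤ q ^ 2 * n ^ (q - 1) := by
  refine card_le_sq_mul_of_pairs _ (fun p => {y | p.1 ≠ p.2 ∧ y p.1 = y p.2})
    (fun p => ?_) fun y hy => ?_
  · refine card_le_of_determined p.2 _ fun y hy z hz h => funext fun i => ?_
    by_cases hi : i = p.2
    · have hy' := (mem_filter.1 hy).2
      have hz' := (mem_filter.1 hz).2
      rw [hi, ← hy'.2, ← hz'.2, h _ hy'.1]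
    · exact h i hi
  · have h := (mem_filter.1 hy).2
    simp only [Function.Injective, not_forall] at h
    obtain ⟨i, j, hij, hne⟩ := h
    exact ⟨(i, j), by simpa using ⟨hne, hij⟩⟩

/-- The digraph on tuples in which `x` points to `y` if the range of `x` together with any entry
of `y` is an edge. -/
def TupleAdj {q n : ℕ} (E : Finset (Finset (Fin n))) (x y : Fin q → Fin n) : Prop :=
  ∀ j, insert (y j) (univ.image x) ∈ E

/-- An injective tuple points to at least `δ ^ q` tuples, where `δ` is the minimum codegree. -/
theorem hdeg_pow_le_card_tupleAdj {q n : ℕ} {E : Finset (Finset (Fin n))}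
    (hE : ∀ e ∈ E, #e = q + 1) {x : Fin q → Fin n} (hx : Function.Injective x) :
    hdeg E (univ.image x) ^ q ≤ #{y : Fin q → Fin n | TupleAdj E x y} := by
  have hcx : #(univ.image x) = q := by simp [card_image_of_injective _ hx]
  set W : Finset (Fin n) := {a | insert a (univ.image x) ∈ E} with hW
  have h1 : hdeg E (univ.image x) ≤ #W := by
    refine (card_le_card (t := W.image fun a => insert a (univ.image x)) ?_).trans card_image_le
    intro e he
    obtain ⟨heE, hsub⟩ := mem_filter.1 he
    have h2 : #(e \ univ.image x) = 1 := by
      rw [card_sdiff_of_subset hsub, hE e heE, hcx]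
      omega
    obtain ⟨a, ha⟩ := card_eq_one.1 h2
    have h3 : insert a (univ.image x) = e := by
      rw [insert_eq, ← ha, sdiff_union_of_subset hsub]
    exact mem_image.2 ⟨a, by rw [hW, mem_filter, h3]; exact ⟨mem_univ _, heE⟩, h3⟩
  calc hdeg E (univ.image x) ^ q ≤ #W ^ q := Nat.pow_le_pow_left h1 q
    _ = #(Fintype.piFinset fun _ : Fin q => W) := by simp
    _ ≤ _ := card_le_card fun y hy => by
      rw [Fintype.mem_piFinset] at hy
      exact mem_filter.2 ⟨mem_univ _, fun j => (mem_filter.1 (hy j)).2⟩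

/-- A cycle of pairwise disjoint injective tuples is a copy of the zycle. -/
theorem hasCopy_zycle_of_isFreeCycle {k n ℓ : ℕ} {E : Finset (Finset (Fin n))}
    {y : ℕ → Fin (k - 1) → Fin n}
    (h : IsFreeCycle TuplesMeet {x | Function.Injective x} (TupleAdj E) ℓ y) :
    HasCopy (zycle k ℓ) E := by
  obtain ⟨hV, hA, hC⟩ := h
  refine ⟨fun p => y p.1 p.2, ?_, ?_⟩
  · rintro ⟨i, a⟩ ⟨j, b⟩ hab
    dsimp only at hab
    have hij : i = j := by
      by_contra hne
      exact hC i i.2 j j.2 (fun h => hne (Fin.ext h)) ⟨a, b, hab⟩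
    subst hij
    rw [(mem_filter.1 (hV i i.2)).2 hab]
  · intro e he
    obtain ⟨⟨i, j⟩, -, rfl⟩ := mem_image.1 he
    have h1 := hA i i.2 j
    rw [image_insert, image_image]
    exact h1

/-- The choice of constants: when `n` is large, lower-order losses are absorbed. -/
theorem exists_threshold {α K : ℝ} {m q : ℕ} (hα : 0 < α) (hm : 1 < (m + 1) * α) :
    ∃ n₀ : ℕ, 1 ≤ n₀ ∧ ∀ n ≥ n₀, 2 * (q : ℝ) ^ 2 ≤ α * n ∧
      (n : ℝ) / (m + 1) + K ≤ α * n := by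
  have hβ : 0 < α - 1 / (m + 1) := by
    rw [sub_pos, div_lt_iff₀ (by positivity)]
    linarith
  obtain ⟨a, ha⟩ := exists_nat_ge (2 * (q : ℝ) ^ 2 / α)
  obtain ⟨b, hb⟩ := exists_nat_ge (K / (α - 1 / (m + 1)))
  refine ⟨a + b + 1, by omega, fun n hn => ?_⟩
  have hn' : (a : ℝ) + b + 1 ≤ n := by exact_mod_cast hn
  have ha0 : (0 : ℝ) ≤ a := by positivity
  have hb0 : (0 : ℝ) ≤ b := by positivity
  rw [div_le_iff₀ hα] at ha
  rw [div_le_iff₀ hβ] at hb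
  have h1 : (a : ℝ) * α ≤ n * α := by gcongr; linarith
  have h2 : (b : ℝ) * (α - 1 / (m + 1)) ≤ n * (α - 1 / (m + 1)) := by gcongr; linarith
  refine ⟨by linarith, ?_⟩
  have h3 : (n : ℝ) * (α - 1 / (m + 1)) = α * n - n / (m + 1) := by ring
  linarith

/-- Large minimum codegree forces a short even cycle of pairwise disjoint injective tuples. -/
theorem exists_even_isFreeCycle_tupleAdj {q : ℕ} (hq : 1 ≤ q) {d : ℝ} (hd0 : 0 < d)
    (hd1 : d ≤ 1) :
    ∃ n₀ : ℕ, ∀ n ≥ n₀, ∀ E : Finset (Finset (Fin n)), (∀ e ∈ E, #e = q + 1) →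
      (∀ s : Finset (Fin n), #s = q → d * n ≤ (hdeg E s : ℝ)) →
      ∃ p : ℕ, 1 ≤ p ∧ p ≤ ⌈d⁻¹ ^ (2 * q)⌉₊ + 1 ∧ ∃ y : ℕ → Fin q → Fin n,
        IsFreeCycle TuplesMeet {x | Function.Injective x} (TupleAdj E)
          (2 * p) y := by
  set α : ℝ := d ^ q with hα
  have hα0 : 0 < α := pow_pos hd0 q
  set m : ℕ := ⌊α⁻¹⌋₊ with hm
  have hmα : 1 < (m + 1) * α := by
    rw [← div_lt_iff₀ hα0, one_div]
    exact Nat.lt_floor_add_one _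
  have hmle : (m : ℝ) ≤ α⁻¹ := Nat.floor_le (by positivity)
  have hmt : 2 * m ≤ ⌈d⁻¹ ^ (2 * q)⌉₊ + 1 := by
    have h1 : d⁻¹ ^ (2 * q) = α⁻¹ ^ 2 := by rw [hα, mul_comm, pow_mul, inv_pow]
    have h2 : (d⁻¹ ^ (2 * q) : ℝ) ≤ ⌈d⁻¹ ^ (2 * q)⌉₊ := Nat.le_ceil _
    have h3 : (2 * m : ℝ) ≤ ⌈d⁻¹ ^ (2 * q)⌉₊ + 1 := by
      nlinarith [sq_nonneg (α⁻¹ - 1)]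
    exact_mod_cast h3
  obtain ⟨n₀, hn₀, hlarge⟩ := exists_threshold (q := q)
    (K := q ^ 2 * (2 + 8 * m / α + m * (2 * m + 2))) hα0 hmα
  refine ⟨n₀, fun n hn E hE hdeg' => ?_⟩
  obtain ⟨hn1, hn2⟩ := hlarge n hn
  have hnpos : 1 ≤ n := hn₀.trans hn
  set c : ℕ := q ^ 2 * n ^ (q - 1) with hcdef
  set V : Finset (Fin q → Fin n) := {x | Function.Injective x} with hV
  have hsymm : ∀ x y : Fin q → Fin n, TuplesMeet x y → TuplesMeet y x :=
    fun x y ⟨i, j, h⟩ => ⟨j, i, h.symm⟩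
  have hc : ∀ v : Fin q → Fin n, #{y | TuplesMeet v y} ≤ c := card_filter_tuplesMeet_le
  have hcardV : #V ≤ n ^ q := by
    simpa using card_le_univ V
  have hc1 : (1 : ℝ) ≤ c := by
    have : 1 ≤ c := Nat.one_le_iff_ne_zero.2 (by positivity)
    exact_mod_cast this
  have hnq : (n : ℝ) ^ q = n * (n : ℝ) ^ (q - 1) := by
    rw [← pow_succ', Nat.sub_add_cancel (by omega)]
  have hcR : (c : ℝ) = q ^ 2 * (n : ℝ) ^ (q - 1) := by rw [hcdef]; push_cast; ring
  have hout : ∀ x ∈ V, α * n ^ q - c ≤ (#{y ∈ V | TupleAdj E x y} : ℝ) := by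
    intro x hx
    have hxi : Function.Injective x := (mem_filter.1 hx).2
    have h1 := hdeg_pow_le_card_tupleAdj hE hxi
    have h2 : d * n ≤ (hdeg E (univ.image x) : ℝ) :=
      hdeg' (univ.image x) (by simp [card_image_of_injective _ hxi])
    have h3 : α * n ^ q ≤ (hdeg E (univ.image x) : ℝ) ^ q := by
      rw [hα, ← mul_pow]
      gcongr
    have h4 : #{y : Fin q → Fin n | TupleAdj E x y} ≤ #{y ∈ V | TupleAdj E x y} + c := by
      refine (card_le_card (t := {y ∈ V | TupleAdj E x y} ∪
        ({y | ¬ Function.Injective y} : Finset (Fin q → Fin n))) fun y hy => ?_).trans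
        ((card_union_le _ _).trans (Nat.add_le_add_left (card_filter_not_injective_le q n) _))
      simp only [hV, mem_union, mem_filter, mem_univ, true_and] at hy ⊢
      tauto
    have h5 : (hdeg E (univ.image x) : ℝ) ^ q ≤ #{y ∈ V | TupleAdj E x y} + c := by
      exact_mod_cast h1.trans h4
    linarith
  have hun : (0 : ℝ) < (n : ℝ) ^ (q - 1) := by positivity
  have hDhalf : α * n ^ q / 2 ≤ α * n ^ q - c := by
    rw [hcR, hnq]
    nlinarith
  have hDpos : 0 < α * (n : ℝ) ^ q - c := lt_of_lt_of_le (by positivity) hDhalf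
  set T₂ : ℕ := 4 * m * c with hT₂
  have htwo : ∀ x ∈ V, n ^ q / (m + 1) + 1 + m * ((2 * m + 1) * c + c) ≤
      #{y ∈ V | ManyTwoStep V (TupleAdj E) T₂ x y} := by
    intro x hx
    have h1 := le_outDegree_two_step (T := T₂) hDpos hout hx
    have h2 : (#V * T₂ : ℝ) / (α * n ^ q - c) ≤ 2 * T₂ / α := by
      have hVR : (#V : ℝ) ≤ (n : ℝ) ^ q := by exact_mod_cast hcardV
      calc (#V * T₂ : ℝ) / (α * n ^ q - c) ≤ n ^ q * T₂ / (α * n ^ q / 2) := by gcongr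
        _ = 2 * T₂ / α := by field_simp
    have h3 : ((n ^ q / (m + 1) : ℕ) : ℝ) ≤ n ^ q / (m + 1) := by
      have := Nat.cast_div_le (α := ℝ) (m := n ^ q) (n := m + 1)
      push_cast at this
      exact this
    have h4 : (n : ℝ) ^ q / (m + 1) + c * (2 + 8 * m / α + m * (2 * m + 2)) ≤ α * n ^ q := by
      have := mul_le_mul_of_nonneg_right hn2 hun.le
      rw [hcR, hnq]
      calc _ = ((n : ℝ) / (m + 1) + q ^ 2 * (2 + 8 * m / α + m * (2 * m + 2))) *
            n ^ (q - 1) := by ring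
        _ ≤ _ := this
        _ = _ := by ring
    have h5 : (2 * T₂ : ℝ) / α = c * (8 * m / α) := by
      rw [hT₂]
      push_cast
      ring
    have h6 : ((n ^ q / (m + 1) : ℕ) : ℝ) + 1 + m * ((2 * m + 1) * c + c) ≤
        #{y ∈ V | ManyTwoStep V (TupleAdj E) T₂ x y} := by
      refine le_trans ?_ h1
      nlinarith
    exact_mod_cast h6
  have hVne : V.Nonempty := by
    have hα1 : α ≤ 1 := pow_le_one₀ hd0.le hd1
    have hqn : q ≤ n := by
      have h1 : (1 : ℝ) ≤ q := by exact_mod_cast (by omega : 1 ≤ q)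
      have h2 : (q : ℝ) ≤ n := by
        have h3 : α * n ≤ 1 * n := by gcongr
        nlinarith
      exact_mod_cast h2
    exact ⟨Fin.castLE hqn, mem_filter.2 ⟨mem_univ _, Fin.castLE_injective hqn⟩⟩
  have hV_lt : #V < (m + 1) * (n ^ q / (m + 1) + 1) :=
    hcardV.trans_lt (Nat.lt_mul_div_succ _ (Nat.succ_pos m))
  obtain ⟨p, x, hp1, hp2, hcyc⟩ := exists_isFreeCycle (c := c) (T := (2 * m + 1) * c)
    (ρ := n ^ q / (m + 1) + 1) hsymm hc (Nat.succ_pos _) m le_rfl V hVne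
    (ManyTwoStep V (TupleAdj E) T₂) hV_lt htwo
  obtain ⟨y, hy⟩ := hcyc.double hsymm hc (T := T₂) (Nat.mul_le_mul_right c (by omega))
  exact ⟨p, hp1, hp2.trans hmt, y, hy⟩

/-- Let `k ≥ 3` be an integer, `d ∈ (0,1)`, and `t = ⌈d^{−2(k−1)}⌉ + 1`. For every
`ε > 0` there exists `n₀` such that every `k`-uniform hypergraph `H` on `n ≥ n₀` vertices with
minimum codegree `δ(H) ≥ (d+ε)n` contains a copy of `Z_{2r}^{(k)}` for some `r ∈ {1, …, t}`. -/
theorem statement7 (k : ℕ) (hk : 3 ≤ k) (d : ℝ) (hd : d ∈ Set.Ioo (0 : ℝ) 1) :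
    ∀ ε : ℝ, 0 < ε → ∃ n₀ : ℕ, ∀ n ≥ n₀, ∀ E : Finset (Finset (Fin n)),
      (∀ e ∈ E, e.card = k) →
      (∀ s : Finset (Fin n), s.card = k - 1 → (d + ε) * n ≤ (hdeg E s : ℝ)) →
      ∃ r : ℕ, 1 ≤ r ∧ r ≤ ⌈d⁻¹ ^ (2 * (k - 1))⌉₊ + 1 ∧ HasCopy (zycle k (2 * r)) E := by
  intro ε hε
  obtain ⟨n₀, h⟩ := exists_even_isFreeCycle_tupleAdj (q := k - 1) (by omega) hd.1 hd.2.le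
  refine ⟨n₀, fun n hn E hE hdeg' => ?_⟩
  obtain ⟨p, hp1, hp2, y, hy⟩ := h n hn E (fun e he => by rw [hE e he]; omega) fun s hs => by
    refine le_trans ?_ (hdeg' s hs)
    gcongr
    linarith
  exact ⟨p, hp1, hp2, hasCopy_zycle_of_isFreeCycle hy⟩
end

section
/- Let k ≥ 3 and ℓ ≥ 2 be integers, let p be a prime with p > k and p > (k−1)^ℓ + 1, and let n be divisible by p. Then 𝔽_p^{(k)}(n) contains no copy of the zycle Z_ℓ^{(k)}. -/
open Finset

open scoped Classical

/-- The k-graph `𝔽_p^{(k)}(p·m)`: vertices are `Fin p × Fin m`, where `V_i = {i} × Fin m` and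
`𝔣(v) = v.1` (as an element of `ZMod p`). A `k`-set `e` is an edge iff either the `𝔣`-values sum
to `0 mod p` and not all of them are `0`, or `k−1` of its vertices lie in `V_0` and the remaining
one lies in `V_1`. -/
noncomputable def fpEdges (k p m : ℕ) : Finset (Finset (Fin p × Fin m)) :=
  Finset.univ.filter fun e : Finset (Fin p × Fin m) =>
    e.card = k ∧
      ((∑ v ∈ e, ((v.1 : ℕ) : ZMod p) = 0 ∧ ∃ v ∈ e, ((v.1 : ℕ) : ZMod p) ≠ 0) ∨
       ((e.filter fun v => ((v.1 : ℕ) : ZMod p) = 0).card = k - 1 ∧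
        (e.filter fun v => ((v.1 : ℕ) : ZMod p) = 1).card = 1))

/-- A vertex weighting by `ZMod p` puts the edge formed by the layer `u` and a vertex of weight `y`
in `𝔽_p`: it has weight zero without being entirely zero, or its weights are one `1` and otherwise
`0`. -/
def LayerEdge {p m : ℕ} (u : Fin m → ZMod p) (y : ZMod p) : Prop :=
  (∑ a, u a + y = 0 ∧ (y ≠ 0 ∨ ∃ a, u a ≠ 0)) ∨
    (y = 1 ∧ ∀ a, u a = 0) ∨ (y = 0 ∧ ∃ a, u = Pi.single a 1)

lemma LayerEdge.eq_of_const {p m : ℕ} (hm : 2 ≤ m) {c y : ZMod p} (hc : c ≠ 0)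
    (h : LayerEdge (fun _ : Fin m => c) y) : y = -(m : ZMod p) * c := by
  rcases h with ⟨h, -⟩ | ⟨-, h⟩ | ⟨-, a, h⟩
  · simp only [sum_const, card_univ, Fintype.card_fin, nsmul_eq_mul] at h
    linear_combination h
  · exact absurd (h ⟨0, by omega⟩) hc
  · have : Nontrivial (Fin m) := Fin.nontrivial_iff_two_le.2 hm
    obtain ⟨b, hb⟩ := exists_ne a
    have := congrFun h b
    rw [Pi.single_eq_of_ne hb] at this
    exact absurd this hc

lemma neg_natCast_pow_ne_one {p m ℓ : ℕ} (hm : 2 ≤ m) (hℓ : ℓ ≠ 0) (hp : m ^ ℓ + 1 < p) :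
    (-(m : ZMod p)) ^ ℓ ≠ 1 := by
  intro h
  have h1 : 1 < m ^ ℓ := Nat.one_lt_pow hℓ (by omega)
  rw [neg_pow] at h
  rcases neg_one_pow_eq_or (ZMod p) ℓ with h' | h' <;> rw [h'] at h
  · have h2 : ((m ^ ℓ : ℕ) : ZMod p) = (1 : ℕ) := by push_cast; linear_combination h
    rw [ZMod.natCast_eq_natCast_iff', Nat.mod_eq_of_lt (by omega),
      Nat.mod_eq_of_lt (by omega)] at h2
    omega
  · have h2 : ((m ^ ℓ + 1 : ℕ) : ZMod p) = 0 := by push_cast; linear_combination -h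
    rw [ZMod.natCast_eq_zero_iff] at h2
    have := Nat.le_of_dvd (by omega) h2
    omega

/-- No weighting that is periodic along the layers makes all edges of a zycle edges of `𝔽_p`. -/
lemma not_forall_layerEdge {p m ℓ : ℕ} (hp : p.Prime) (hm : 2 ≤ m) (hmp : m + 1 < p)
    (hℓ : ℓ ≠ 0) (hpℓ : m ^ ℓ + 1 < p) (x : ℕ → Fin m → ZMod p)
    (hper : ∀ i, x (i + ℓ) = x i) : ¬ ∀ i j, LayerEdge (x i) (x (i + 1) j) := by
  intro h
  have : Fact p.Prime := ⟨hp⟩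
  have hm0 : (m : ZMod p) ≠ 0 := by
    rw [Ne, ZMod.natCast_eq_zero_iff]
    intro hd
    have := Nat.le_of_dvd (by omega) hd
    omega
  have h2 : (2 : ZMod p) ≠ 0 := by
    have : ((2 : ℕ) : ZMod p) ≠ 0 := by
      rw [Ne, ZMod.natCast_eq_zero_iff]
      intro hd
      have := Nat.le_of_dvd (by omega) hd
      omega
    simpa using this
  have hconst_ne (i : ℕ) (c : ZMod p) (hc : c ≠ 0) : x i ≠ fun _ => c := by
    intro hi
    have key (t : ℕ) : x (i + t) = fun _ => (-(m : ZMod p)) ^ t * c := by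
      induction t with
      | zero => simpa using hi
      | succ t ih =>
        funext j
        have hj := h (i + t) j
        rw [ih] at hj
        have := hj.eq_of_const hm (mul_ne_zero (pow_ne_zero _ (neg_ne_zero.2 hm0)) hc)
        rw [← add_assoc, this]
        ring
    have hr := congrFun ((key ℓ).symm.trans ((hper i).trans hi)) ⟨0, by omega⟩
    exact neg_natCast_pow_ne_one hm hℓ hpℓ (mul_right_cancel₀ hc (by simpa using hr))
  have hconst (i : ℕ) (c : ZMod p) : x i ≠ fun _ => c := by
    by_cases hc : c = 0
    · rintro hi
      apply hconst_ne (i + 1) 1 one_ne_zero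
      funext j
      have hj := h i j
      rw [hi, hc] at hj
      rcases hj with ⟨h1, h3⟩ | ⟨h1, -⟩ | ⟨-, a, ha⟩
      · simp_all
      · exact h1
      · simpa using congrFun ha a
    · exact hconst_ne i c hc
  have hcases (i : ℕ) (j : Fin m) :
      ∑ a, x i a + x (i + 1) j = 0 ∨ (x (i + 1) j = 0 ∧ ∃ a, x i = Pi.single a 1) := by
    rcases h i j with h1 | h1 | h1
    · exact Or.inl h1.1
    · exact absurd (funext h1.2) (hconst i 0)
    · exact Or.inr h1
  have hsingle (i : ℕ) : ∃ a, x i = Pi.single a 1 := by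
    by_contra hi
    apply hconst (i + 1) (-∑ a, x i a)
    funext j
    rcases hcases i j with h1 | h1
    · linear_combination h1
    · exact absurd h1.2 hi
  obtain ⟨a, ha⟩ := hsingle 0
  obtain ⟨b, hb⟩ := hsingle 1
  have hb1 : x 1 b = 1 := by simp [hb]
  have hS : ∑ c, x 0 c = 1 := by simp [ha]
  rcases hcases 0 b with h1 | ⟨h1, -⟩
  · rw [hS, zero_add, hb1] at h1
    exact h2 (by linear_combination h1)
  · rw [zero_add, hb1] at h1
    exact one_ne_zero h1

lemma exists_unique_one_of_card {α R : Type*} [DecidableEq α] [Zero R] [One R] [NeZero (1 : R)]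
    [DecidableEq R] {e : Finset α} {w : α → R} {k : ℕ} (hk : 1 ≤ k) (he : e.card = k)
    (h0 : (e.filter fun v => w v = 0).card = k - 1)
    (h1 : (e.filter fun v => w v = 1).card = 1) :
    ∃ v ∈ e, w v = 1 ∧ ∀ u ∈ e, u ≠ v → w u = 0 := by
  obtain ⟨v, hv⟩ := card_eq_one.1 h1
  have hv' : v ∈ e ∧ w v = 1 := by
    rw [← mem_filter (p := fun v => w v = 1), hv]
    exact mem_singleton_self v
  have hne : (e.filter fun v => ¬ w v = 0).card = 1 := by
    have := card_filter_add_card_filter_not (s := e) (fun v => w v = 0)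
    omega
  refine ⟨v, hv'.1, hv'.2, fun u hu huv => ?_⟩
  by_contra hu0
  exact huv (card_le_one.1 hne.le u (mem_filter.2 ⟨hu, hu0⟩) v
    (mem_filter.2 ⟨hv'.1, by rw [hv'.2]; exact one_ne_zero⟩))

lemma layerEdge_of_mem_fpEdges {k p m r : ℕ} (hk : 1 ≤ k) (hp : 1 < p)
    {g : Fin r → Fin p × Fin m} (hg : Function.Injective g) {v : Fin p × Fin m}
    (hv : ∀ a, g a ≠ v) (h : insert v (univ.image g) ∈ fpEdges k p m) :
    LayerEdge (fun a => (((g a).1 : ℕ) : ZMod p)) ((v.1 : ℕ) : ZMod p) := by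
  have : Fact (1 < p) := ⟨hp⟩
  have hvn : v ∉ univ.image g := by simpa using hv
  simp only [fpEdges, mem_filter, mem_univ, true_and] at h
  obtain ⟨hcard, ⟨hsum, u, hu, hu0⟩ | ⟨h0, h1⟩⟩ := h
  · refine Or.inl ⟨?_, ?_⟩
    · rw [sum_insert hvn, sum_image (fun a _ b _ hab => hg hab)] at hsum
      rw [add_comm]
      exact hsum
    · rcases mem_insert.1 hu with rfl | hu
      · exact Or.inl hu0
      · obtain ⟨a, -, rfl⟩ := mem_image.1 hu
        exact Or.inr ⟨a, hu0⟩
  · obtain ⟨u, hu, hu1, hz⟩ := exists_unique_one_of_card hk hcard h0 h1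
    have hga (a : Fin r) : g a ∈ insert v (univ.image g) := by simp
    rcases mem_insert.1 hu with rfl | hu
    · exact Or.inr (Or.inl ⟨hu1, fun a => hz _ (hga a) (hv a)⟩)
    · obtain ⟨a, -, rfl⟩ := mem_image.1 hu
      refine Or.inr (Or.inr ⟨hz _ (mem_insert_self _ _) (hv a).symm, a, funext fun b => ?_⟩)
      by_cases hb : b = a
      · subst hb
        simpa using hu1
      · rw [Pi.single_eq_of_ne hb]
        exact hz _ (hga b) (hg.ne hb)

/-- Let `k ≥ 3` and `ℓ ≥ 2` be integers, `p` a prime with `p > k` and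
`p > (k−1)^ℓ + 1`, and `n` divisible by `p`. Then `𝔽_p^{(k)}(n)` contains no copy of the zycle
`Z_ℓ^{(k)}`. -/
theorem statement10 (k ℓ p n : ℕ) (hk : 3 ≤ k) (hℓ : 2 ≤ ℓ) (hp : p.Prime) (hkp : k < p)
    (hpℓ : (k - 1) ^ ℓ + 1 < p) (hn : p ∣ n) :
    ¬ HasCopy (zycle k ℓ) (fpEdges k p (n / p)) := by
  rintro ⟨f, hf, hE⟩
  have hℓ0 : 0 < ℓ := by omega
  refine not_forall_layerEdge hp (m := k - 1) (by omega) (by omega) hℓ0.ne' hpℓ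
    (fun i j => (((f (⟨i % ℓ, Nat.mod_lt _ hℓ0⟩, j)).1 : ℕ) : ZMod p))
    (fun i => by simp) fun i j => ?_
  refine layerEdge_of_mem_fpEdges (k := k) (by omega) hp.one_lt
    (g := fun a => f (⟨i % ℓ, Nat.mod_lt _ hℓ0⟩, a))
    (fun a b hab => (Prod.ext_iff.1 (hf hab)).2) (fun a hab => ?_) ?_
  · have h := congrArg Fin.val (Prod.ext_iff.1 (hf hab)).1
    change i % ℓ = (i + 1) % ℓ at h
    have h' : 0 ≡ 1 [MOD ℓ] := Nat.ModEq.add_left_cancel' i h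
    rw [Nat.ModEq, Nat.zero_mod, Nat.mod_eq_of_lt (by omega)] at h'
    omega
  · have h := hE _ (mem_image_of_mem _ (mem_univ (⟨i % ℓ, Nat.mod_lt _ hℓ0⟩, j)))
    simpa [image_insert, image_image, Function.comp_def] using h
end

section
/- Let k ≥ 3 be an integer, p > k a prime, and n divisible by p. Suppose e_1, …, e_r (r ≥ 2) are pairwise disjoint (k−1)-element subsets of V(𝔽_p^{(k)}(n)) with e_i ▷ e_{i+1} for every i ∈ [r], indices taken modulo r (i.e., they form a copy of Z_r^{(k)}). Then there exist i_0 ∈ [r] and j ∈ {1, …, p−1} such that e_{i_0} ⊆ V_j. -/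
open Finset

open scoped Classical

/-- Unfolding of when `insert v e` is an edge of `fpEdges k p m`, for `v ∉ e`. -/
lemma insert_mem_fpEdges_cases {k p m : ℕ} [Fact p.Prime]
    {e : Finset (Fin p × Fin m)} {v : Fin p × Fin m} (hv : v ∉ e)
    (h : insert v e ∈ fpEdges k p m) :
    (((v.1 : ℕ) : ZMod p) = -∑ w ∈ e, ((w.1 : ℕ) : ZMod p) ∧
        ∃ w ∈ insert v e, ((w.1 : ℕ) : ZMod p) ≠ 0) ∨
      ((∀ w ∈ e, ((w.1 : ℕ) : ZMod p) = 0) ∧ ((v.1 : ℕ) : ZMod p) = 1) ∨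
      (((v.1 : ℕ) : ZMod p) = 0 ∧ ∃ u ∈ e, ((u.1 : ℕ) : ZMod p) = 1 ∧
        ∑ w ∈ e, ((w.1 : ℕ) : ZMod p) = 1) := by
  set g : Fin p × Fin m → ZMod p := fun w => ((w.1 : ℕ) : ZMod p)
  change (g v = -∑ w ∈ e, g w ∧ ∃ w ∈ insert v e, g w ≠ 0) ∨ ((∀ w ∈ e, g w = 0) ∧ g v = 1) ∨
    (g v = 0 ∧ ∃ u ∈ e, g u = 1 ∧ ∑ w ∈ e, g w = 1)
  have h' : (insert v e).card = k ∧ ((∑ w ∈ insert v e, g w = 0 ∧ ∃ w ∈ insert v e, g w ≠ 0) ∨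
      (((insert v e).filter fun w => g w = 0).card = k - 1 ∧
        ((insert v e).filter fun w => g w = 1).card = 1)) := by
    simpa only [fpEdges, mem_filter, mem_univ, true_and] using h
  obtain ⟨hc, ⟨hs, hne⟩ | ⟨h0, h1⟩⟩ := h'
  · rw [sum_insert hv] at hs
    exact Or.inl ⟨eq_neg_of_add_eq_zero_left hs, hne⟩
  · right
    -- Every vertex of the edge has value `0` or `1`
    have hdis : Disjoint ((insert v e).filter fun w => g w = 0)
        ((insert v e).filter fun w => g w = 1) := by
      rw [disjoint_filter]
      intro w _ hw0 hw1
      exact zero_ne_one (hw0.symm.trans hw1)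
    have hall := eq_of_subset_of_card_le
      (union_subset (filter_subset (fun w => g w = 0) (insert v e))
        (filter_subset (fun w => g w = 1) (insert v e)))
      (by rw [card_union_of_disjoint hdis, h0, h1, hc]; omega)
    obtain ⟨u, hu⟩ := card_eq_one.1 h1
    have hu' : u ∈ insert v e ∧ g u = 1 := by
      simpa using (hu ▸ mem_singleton_self u : u ∈ (insert v e).filter fun w => g w = 1)
    have huniq : ∀ w ∈ insert v e, w ≠ u → g w = 0 := by
      intro w hw hwu
      rw [← hall] at hw
      rcases mem_union.1 hw with hw | hw
      · exact (mem_filter.1 hw).2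
      · rw [hu] at hw
        exact absurd (mem_singleton.1 hw) hwu
    rcases mem_insert.1 hu'.1 with rfl | hue
    · exact Or.inl ⟨fun w hw => huniq w (mem_insert_of_mem hw) fun h => hv (h ▸ hw), hu'.2⟩
    · refine Or.inr ⟨huniq v (mem_insert_self v e) fun h => hv (h ▸ hue), u, hue, hu'.2, ?_⟩
      rw [sum_eq_single_of_mem u hue fun w hw hwu => huniq w (mem_insert_of_mem hw) hwu, hu'.2]

/-- If `e ▷ f` then either `f` lies in a single class `V_j` with `j ≠ 0`, or `f` lies in `V_0`,
while `e` does not, or `e` meets `V_1` and `f` is contained in `V_0 ∪ V_{-1}`. -/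
lemma Tri.fpEdges_cases {k p m : ℕ} [Fact p.Prime]
    {e f : Finset (Fin p × Fin m)} (hef : Disjoint e f)
    (h : Tri (fpEdges k p m) e f) :
    (∃ j : ZMod p, j ≠ 0 ∧ ∀ v ∈ f, ((v.1 : ℕ) : ZMod p) = j) ∨
      ((∃ w ∈ e, ((w.1 : ℕ) : ZMod p) ≠ 0) ∧ ∀ v ∈ f, ((v.1 : ℕ) : ZMod p) = 0) ∨
      ((∃ u ∈ e, ((u.1 : ℕ) : ZMod p) = 1) ∧
        ∀ v ∈ f, ((v.1 : ℕ) : ZMod p) = 0 ∨ ((v.1 : ℕ) : ZMod p) = -1) := by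
  have key := fun v (hv : v ∈ f) =>
    insert_mem_fpEdges_cases (disjoint_right.1 hef hv) (h v hv)
  by_cases hz : ∀ w ∈ e, ((w.1 : ℕ) : ZMod p) = 0
  · refine Or.inl ⟨1, one_ne_zero, fun v hv => ?_⟩
    rcases key v hv with ⟨hs, w, hw, hne⟩ | ⟨-, h1⟩ | ⟨-, u, hu, hu1, -⟩
    · rw [sum_eq_zero hz, neg_zero] at hs
      rcases mem_insert.1 hw with rfl | hw
      · exact absurd hs hne
      · exact absurd (hz w hw) hne
    · exact h1
    · exact absurd ((hz u hu).symm.trans hu1) zero_ne_one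
  · by_cases ht : (∃ u ∈ e, ((u.1 : ℕ) : ZMod p) = 1) ∧ ∑ w ∈ e, ((w.1 : ℕ) : ZMod p) = 1
    · refine Or.inr (Or.inr ⟨ht.1, fun v hv => ?_⟩)
      rcases key v hv with ⟨hs, -⟩ | ⟨h0, -⟩ | ⟨h0, -⟩
      · exact Or.inr (hs.trans (by rw [ht.2]))
      · exact absurd h0 hz
      · exact Or.inl h0
    · have hmono : ∀ v ∈ f, ((v.1 : ℕ) : ZMod p) = -∑ w ∈ e, ((w.1 : ℕ) : ZMod p) := by
        intro v hv
        rcases key v hv with ⟨hs, -⟩ | ⟨h0, -⟩ | ⟨-, u, hu, hu1, hs⟩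
        · exact hs
        · exact absurd h0 hz
        · exact absurd ⟨⟨u, hu, hu1⟩, hs⟩ ht
      by_cases hs : -∑ w ∈ e, ((w.1 : ℕ) : ZMod p) = 0
      · refine Or.inr (Or.inl ⟨?_, fun v hv => (hmono v hv).trans hs⟩)
        push Not at hz
        exact hz
      · exact Or.inl ⟨_, hs, hmono⟩

/-- Let `k ≥ 3`, `p > k` prime, `p ∣ n`. Suppose `e_1, …, e_r` (`r ≥ 2`) are
pairwise disjoint `(k−1)`-sets of vertices of `𝔽_p^{(k)}(n)` with `e_i ▷ e_{i+1}` for every `i`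
(indices modulo `r`), i.e. they form a copy of `Z_r^{(k)}`. Then there are `i₀ ∈ [r]` and
`j ∈ {1, …, p−1}` with `e_{i₀} ⊆ V_j`. -/
theorem statement11 (k p n : ℕ) (hk : 3 ≤ k) (hp : p.Prime) (hkp : k < p) (hn : p ∣ n)
    (r : ℕ) (hr : 2 ≤ r) (e : Fin r → Finset (Fin p × Fin (n / p)))
    (hcard : ∀ i, (e i).card = k - 1)
    (hdisj : ∀ i j, i ≠ j → Disjoint (e i) (e j))
    (htri : ∀ i : Fin r,
      Tri (fpEdges k p (n / p)) (e i) (e ⟨(i.val + 1) % r, Nat.mod_lt _ i.pos⟩)) :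
    ∃ (i₀ : Fin r) (j : Fin p), j.val ≠ 0 ∧ ∀ v ∈ e i₀, v.1 = j := by
  have : Fact p.Prime := ⟨hp⟩
  set s : Fin r → Fin r := fun i => ⟨(i.val + 1) % r, Nat.mod_lt _ i.pos⟩
  have hsne : ∀ i, i ≠ s i := by
    intro i hi
    have h : i.val = (i.val + 1) % r := congrArg Fin.val hi
    have hlt := i.isLt
    rcases Nat.lt_or_ge (i.val + 1) r with h' | h'
    · rw [Nat.mod_eq_of_lt h'] at h
      omega
    · rw [show i.val + 1 = r by omega, Nat.mod_self] at h
      omega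
  have hstep := fun i => (htri i).fpEdges_cases (hdisj i (s i) (hsne i))
  suffices hmono : ∃ i, ∃ j : ZMod p, j ≠ 0 ∧ ∀ v ∈ e i, ((v.1 : ℕ) : ZMod p) = j by
    obtain ⟨i, j, hj, hv⟩ := hmono
    refine ⟨i, ⟨j.val, j.val_lt⟩, (ZMod.val_ne_zero j).2 hj, fun v hvi => Fin.ext ?_⟩
    change v.1.val = j.val
    rw [← hv v hvi, ZMod.val_natCast_of_lt v.1.isLt]
  by_contra hno
  have hstep' := fun i => (hstep i).resolve_left fun h => hno ⟨s i, h⟩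
  have hnz : ∀ i, ¬ ∀ v ∈ e i, ((v.1 : ℕ) : ZMod p) = 0 := by
    intro i hz
    rcases hstep' i with ⟨⟨w, hw, hne⟩, -⟩ | ⟨⟨u, hu, hu1⟩, -⟩
    · exact hne (hz w hw)
    · exact zero_ne_one ((hz u hu).symm.trans hu1)
  have hshape := fun i => (hstep' i).resolve_left fun h => hnz (s i) h.2
  have i : Fin r := ⟨0, by omega⟩
  obtain ⟨u, hu, hu1⟩ := (hshape (s i)).1
  have : Fact (2 < p) := ⟨by omega⟩
  rcases (hshape i).2 u hu with h | h
  · exact zero_ne_one (h.symm.trans hu1)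
  · exact ZMod.neg_one_ne_one (h.symm.trans hu1)
end

section
/- Let k ≥ 3 be an integer, p > k a prime, and n divisible by p. Let e and f be disjoint (k−1)-element subsets of V(𝔽_p^{(k)}(n)) such that e ⊆ V_j for some j with j ≢ 0 (mod p) and e ▷ f. Then f ⊆ V_m where m ≡ (1−k)·j (mod p). -/
open Finset

open scoped Classical

/-- Let `k ≥ 3`, `p > k` prime, `p ∣ n`. Let `e` and `f` be disjoint `(k−1)`-sets
of vertices of `𝔽_p^{(k)}(n)` with `e ⊆ V_j` for some `j ≢ 0 (mod p)` and `e ▷ f`. Then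
`f ⊆ V_m` where `m ≡ (1−k)·j (mod p)`. -/
theorem statement12 (k p n : ℕ) (hk : 3 ≤ k) (hp : p.Prime) (hkp : k < p) (hn : p ∣ n)
    (e f : Finset (Fin p × Fin (n / p))) (hec : e.card = k - 1) (hfc : f.card = k - 1)
    (hdisj : Disjoint e f) (j : Fin p) (hj : ((j : ℕ) : ZMod p) ≠ 0)
    (hej : ∀ v ∈ e, v.1 = j) (htri : Tri (fpEdges k p (n / p)) e f) :
    ∀ v ∈ f, ((v.1 : ℕ) : ZMod p) = (1 - (k : ZMod p)) * ((j : ℕ) : ZMod p) := by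
  intro v hv
  have hve : v ∉ e := fun h => Finset.disjoint_left.mp hdisj h hv
  have hedge := htri v hv
  simp only [fpEdges, Finset.mem_filter, Finset.mem_univ, true_and] at hedge
  obtain ⟨-, ⟨hsum, -⟩ | ⟨hzero, -⟩⟩ := hedge
  · have he : ∑ w ∈ e, ((w.1 : ℕ) : ZMod p) = ((k : ZMod p) - 1) * ((j : ℕ) : ZMod p) := by
      rw [Finset.sum_congr rfl fun w hw => by rw [hej w hw], Finset.sum_const, hec,
        nsmul_eq_mul, Nat.cast_sub (by omega), Nat.cast_one]
    rw [Finset.sum_insert hve, he] at hsum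
    linear_combination hsum
  · have hsub : ((insert v e).filter fun w => ((w.1 : ℕ) : ZMod p) = 0) ⊆ {v} := by
      intro w hw
      obtain ⟨hw, hw0⟩ := Finset.mem_filter.mp hw
      rcases Finset.mem_insert.mp hw with rfl | hw
      · exact Finset.mem_singleton_self _
      · exact absurd (hej w hw ▸ hw0) hj
    have hcard := Finset.card_le_card hsub
    rw [hzero, Finset.card_singleton] at hcard
    omega
end

section
/- Let k ≥ 3 be an integer, p > k a prime, and n divisible by p. If e_1, …, e_r (r ≥ 2) are pairwise disjoint (k−1)-element subsets of V(𝔽_p^{(k)}(n)) with e_i ▷ e_{i+1} for every i ∈ [r], indices taken modulo r (i.e., they form a copy of Z_r^{(k)} in 𝔽_p^{(k)}(n)), then (1−k)^r ≡ 1 (mod p). -/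
open Finset

open scoped Classical

/-- If `g` takes only the values `0` and `1` on `S`, its sum over `S` is the number of ones. -/
lemma sum_eq_card_filter_one {α R : Type*} [Semiring R] [DecidableEq R] (g : α → R) (S : Finset α)
    (h : ∀ u ∈ S, g u = 0 ∨ g u = 1) : ∑ u ∈ S, g u = ((S.filter fun u => g u = 1).card : R) := by
  rw [← Finset.sum_boole]
  refine Finset.sum_congr rfl fun u hu => ?_
  split_ifs with h1
  · exact h1
  · exact (h u hu).resolve_right h1

/-- The sets of zeros and ones exhaust `S` when their sizes add up to at least that of `S`. -/
lemma eq_zero_or_one_of_card_le {α R : Type*} [Semiring R] [Nontrivial R] [DecidableEq R]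
    (g : α → R) (S : Finset α)
    (h : S.card ≤ (S.filter fun u => g u = 0).card + (S.filter fun u => g u = 1).card) :
    ∀ u ∈ S, g u = 0 ∨ g u = 1 := by
  have hd : Disjoint (S.filter fun u => g u = 0) (S.filter fun u => g u = 1) := by
    refine Finset.disjoint_filter.2 fun u _ h0 h1 => zero_ne_one (h0.symm.trans h1)
  rw [← Finset.card_union_of_disjoint hd, ← Finset.filter_or] at h
  intro u hu
  have := Finset.eq_of_subset_of_card_le (Finset.filter_subset _ S) h
  rw [← this] at hu
  exact (Finset.mem_filter.1 hu).2

/-- The three ways in which a `(k-1)`-set `S` extends by a vertex `v` to an edge of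
`𝔽_p^{(k)}`. -/
lemma insert_mem_fpEdges {k p m : ℕ} (hk : 3 ≤ k) [Fact p.Prime]
    {S : Finset (Fin p × Fin m)} (hS : S.card = k - 1) {v : Fin p × Fin m} (hv : v ∉ S)
    (g : Fin p × Fin m → ZMod p) (hg : g = fun v => ((v.1 : ℕ) : ZMod p))
    (h : insert v S ∈ fpEdges k p m) :
    ((∃ u ∈ S, g u ≠ 0) ∧ g v = -∑ u ∈ S, g u) ∨ ((∀ u ∈ S, g u = 0) ∧ g v = 1) ∨
      (g v = 0 ∧ (∃ u ∈ S, g u = 0) ∧ (∃ u ∈ S, g u = 1) ∧ ∑ u ∈ S, g u = 1) := by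
  have hgv : ∀ v, ((v.1 : ℕ) : ZMod p) = g v := fun v => by rw [hg]
  unfold fpEdges at h
  rw [Finset.mem_filter] at h
  simp only [hgv] at h
  obtain ⟨-, -, ⟨hsum, u, hu, hu0⟩ | ⟨h0, h1⟩⟩ := h
  · left
    rw [Finset.sum_insert hv] at hsum
    have hgv' := eq_neg_of_add_eq_zero_left hsum
    refine ⟨?_, hgv'⟩
    by_contra! hall
    rw [Finset.sum_eq_zero hall, neg_zero] at hgv'
    rcases Finset.mem_insert.1 hu with rfl | hu
    · exact hu0 hgv'
    · exact hu0 (hall u hu)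
  · right
    have hn (P : Fin p × Fin m → Prop) [DecidablePred P] : v ∉ S.filter P :=
      fun h => hv (Finset.mem_filter.1 h).1
    rw [Finset.filter_insert] at h0 h1
    by_cases hv0 : g v = 0
    · right
      have hv1 : g v ≠ 1 := by rw [hv0]; exact zero_ne_one
      rw [if_pos hv0, Finset.card_insert_of_notMem (hn _)] at h0
      rw [if_neg hv1] at h1
      refine ⟨hv0, ?_, ?_, ?_⟩
      · obtain ⟨u, hu⟩ := Finset.card_pos.1 (by omega : 0 < (S.filter fun u => g u = 0).card)
        exact ⟨u, Finset.mem_filter.1 hu⟩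
      · obtain ⟨u, hu⟩ := Finset.card_pos.1 (by omega : 0 < (S.filter fun u => g u = 1).card)
        exact ⟨u, Finset.mem_filter.1 hu⟩
      · rw [sum_eq_card_filter_one g S (eq_zero_or_one_of_card_le g S (by omega)), h1, Nat.cast_one]
    · left
      rw [if_neg hv0] at h0
      have hall : ∀ u ∈ S, g u = 0 := Finset.card_filter_eq_iff.1 (h0.trans hS.symm)
      refine ⟨hall, ?_⟩
      by_contra hv1
      rw [if_neg hv1] at h1
      obtain ⟨u, hu⟩ := Finset.card_pos.1 (by omega : 0 < (S.filter fun u => g u = 1).card)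
      rw [Finset.mem_filter] at hu
      exact zero_ne_one ((hall u hu.1).symm.trans hu.2)

/-- For `0 < a < p` the natural number `a` is nonzero in `ZMod p`. -/
lemma natCast_zmod_ne_zero {p a : ℕ} (ha : 0 < a) (hap : a < p) : (a : ZMod p) ≠ 0 := by
  rw [Ne, ZMod.natCast_eq_zero_iff]
  exact fun h => absurd (Nat.le_of_dvd ha h) (by omega)

/-- A sequence of `(k-1)`-sets whose consecutive members satisfy the extension trichotomy of
`insert_mem_fpEdges` contains a set on which `g` is a nonzero constant. -/
lemma exists_const_ne_zero {α : Type*} {k p : ℕ} (hk : 3 ≤ k) (hkp : k < p) [Fact p.Prime]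
    (g : α → ZMod p) (F : ℕ → Finset α) (hF : ∀ i, (F i).card = k - 1)
    (hstep : ∀ i, ∀ v ∈ F (i + 1),
      ((∃ u ∈ F i, g u ≠ 0) ∧ g v = -∑ u ∈ F i, g u) ∨ ((∀ u ∈ F i, g u = 0) ∧ g v = 1) ∨
      (g v = 0 ∧ (∃ u ∈ F i, g u = 0) ∧ (∃ u ∈ F i, g u = 1) ∧ ∑ u ∈ F i, g u = 1)) :
    ∃ i c, c ≠ 0 ∧ ∀ v ∈ F i, g v = c := by
  have hzero : ∀ i, (∀ u ∈ F i, g u = 0) → ∃ i c, c ≠ 0 ∧ ∀ v ∈ F i, g v = c := by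
    intro i hi
    refine ⟨i + 1, 1, one_ne_zero, fun v hv => ?_⟩
    rcases hstep i v hv with ⟨⟨u, hu, hu0⟩, -⟩ | ⟨-, h⟩ | ⟨-, -, ⟨u, hu, hu1⟩, -⟩
    · exact absurd (hi u hu) hu0
    · exact h
    · exact absurd ((hi u hu).symm.trans hu1) zero_ne_one
  by_cases h0 : ∀ u ∈ F 0, g u = 0
  · exact hzero 0 h0
  by_cases hsp : ∑ u ∈ F 0, g u = 1
  · have hval : ∀ v ∈ F 1, g v = 0 ∨ g v = -1 := by
      intro v hv
      rcases hstep 0 v hv with ⟨-, h⟩ | ⟨h, -⟩ | ⟨h, -⟩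
      · right; rw [h, hsp]
      · exact absurd h h0
      · exact Or.inl h
    by_cases h1 : ∀ u ∈ F 1, g u = 0
    · exact hzero 1 h1
    have hone : ∀ v ∈ F 1, g v ≠ 1 := by
      intro v hv h
      rcases hval v hv with h' | h'
      · exact zero_ne_one (h'.symm.trans h)
      · have h2 : ((2 : ℕ) : ZMod p) = 0 := by
          have : (1 : ZMod p) = -1 := h.symm.trans h'
          push_cast
          linear_combination this
        exact natCast_zmod_ne_zero (by omega) (by omega) h2
    have hsum := sum_eq_card_filter_one (fun u => -g u) (F 1) fun u hu => by
      rcases hval u hu with h | h <;> simp [h]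
    rw [Finset.sum_neg_distrib] at hsum
    refine ⟨2, (((F 1).filter fun u => -g u = 1).card : ZMod p), ?_, fun v hv => ?_⟩
    · push Not at h1
      obtain ⟨u, hu, hu0⟩ := h1
      refine natCast_zmod_ne_zero (Finset.card_pos.2 ⟨u, Finset.mem_filter.2 ⟨hu, ?_⟩⟩) ?_
      · rw [(hval u hu).resolve_left hu0, neg_neg]
      · exact (Finset.card_filter_le _ _).trans_lt (by rw [hF]; omega)
    · rcases hstep 1 v hv with ⟨-, h⟩ | ⟨h, -⟩ | ⟨-, -, ⟨u, hu, hu1⟩, -⟩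
      · exact h.trans hsum
      · exact absurd h h1
      · exact absurd hu1 (hone u hu)
  · have hconst : ∀ v ∈ F 1, g v = -∑ u ∈ F 0, g u := by
      intro v hv
      rcases hstep 0 v hv with ⟨-, h⟩ | ⟨h, -⟩ | ⟨-, -, -, h⟩
      · exact h
      · exact absurd h h0
      · exact absurd h hsp
    by_cases hs : -∑ u ∈ F 0, g u = 0
    · exact hzero 1 fun u hu => (hconst u hu).trans hs
    · exact ⟨1, _, hs, hconst⟩

/-- Let `k ≥ 3`, `p > k` prime, `p ∣ n`. If `e_1, …, e_r` (`r ≥ 2`) are pairwise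
disjoint `(k−1)`-sets of vertices of `𝔽_p^{(k)}(n)` with `e_i ▷ e_{i+1}` for every `i ∈ [r]`
(indices modulo `r`), then `(1−k)^r ≡ 1 (mod p)`. -/
theorem statement13 (k p n : ℕ) (hk : 3 ≤ k) (hp : p.Prime) (hkp : k < p) (hn : p ∣ n)
    (r : ℕ) (hr : 2 ≤ r) (e : Fin r → Finset (Fin p × Fin (n / p)))
    (hcard : ∀ i, (e i).card = k - 1)
    (hdisj : ∀ i j, i ≠ j → Disjoint (e i) (e j))
    (htri : ∀ i : Fin r,
      Tri (fpEdges k p (n / p)) (e i) (e ⟨(i.val + 1) % r, Nat.mod_lt _ i.pos⟩)) :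
    (1 - (k : ZMod p)) ^ r = 1 := by
  have : Fact p.Prime := ⟨hp⟩
  have hr0 : 0 < r := by omega
  set g : Fin p × Fin (n / p) → ZMod p := fun v => ((v.1 : ℕ) : ZMod p) with hg
  set F : ℕ → Finset (Fin p × Fin (n / p)) := fun i => e ⟨i % r, Nat.mod_lt _ hr0⟩ with hFdef
  have hF : ∀ i, (F i).card = k - 1 := fun i => hcard _
  have hstep : ∀ i, ∀ v ∈ F (i + 1),
      ((∃ u ∈ F i, g u ≠ 0) ∧ g v = -∑ u ∈ F i, g u) ∨ ((∀ u ∈ F i, g u = 0) ∧ g v = 1) ∨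
      (g v = 0 ∧ (∃ u ∈ F i, g u = 0) ∧ (∃ u ∈ F i, g u = 1) ∧ ∑ u ∈ F i, g u = 1) := by
    intro i v hv
    have hne : i % r ≠ (i + 1) % r := by
      intro h
      have h1 : 1 ≡ 0 [MOD r] := Nat.ModEq.add_left_cancel' i (show i + 1 ≡ i + 0 [MOD r] from h.symm)
      rw [Nat.modEq_zero_iff_dvd] at h1
      exact absurd (Nat.le_of_dvd one_pos h1) (by omega)
    refine insert_mem_fpEdges hk (hF i) (fun hv' => ?_) g hg ?_
    · exact Finset.disjoint_left.1 (hdisj ⟨i % r, Nat.mod_lt _ hr0⟩ ⟨(i + 1) % r, Nat.mod_lt _ hr0⟩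
        (fun h => hne (Fin.mk.inj h))) hv' hv
    · refine htri ⟨i % r, Nat.mod_lt _ hr0⟩ v ?_
      simpa only [hFdef, Nat.mod_add_mod] using hv
  obtain ⟨i, c, hc, hi⟩ := exists_const_ne_zero hk hkp g F hF hstep
  have hk1 : ((k - 1 : ℕ) : ZMod p) ≠ 0 := natCast_zmod_ne_zero (by omega) (by omega)
  have hcast : ((k - 1 : ℕ) : ZMod p) = k - 1 := by rw [Nat.cast_sub (by omega), Nat.cast_one]
  have hk1' : (1 - (k : ZMod p)) ≠ 0 := by
    rw [← neg_sub, ← hcast]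
    exact neg_ne_zero.2 hk1
  have hiter : ∀ j, ∀ v ∈ F (i + j), g v = (1 - (k : ZMod p)) ^ j * c := by
    intro j
    induction j with
    | zero => simpa using hi
    | succ j ih =>
      intro v hv
      have hd : (1 - (k : ZMod p)) ^ j * c ≠ 0 := mul_ne_zero (pow_ne_zero _ hk1') hc
      rcases hstep (i + j) v hv with ⟨-, h⟩ | ⟨h, -⟩ | ⟨-, ⟨u, hu, hu0⟩, -⟩
      · rw [h, Finset.sum_congr rfl ih, Finset.sum_const, hF, nsmul_eq_mul, hcast]
        ring
      · obtain ⟨u, hu⟩ := Finset.card_pos.1 (by rw [hF]; omega : 0 < (F (i + j)).card)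
        exact absurd ((ih u hu).symm.trans (h u hu)) hd
      · exact absurd ((ih u hu).symm.trans hu0) hd
  obtain ⟨v, hv⟩ := Finset.card_pos.1 (by rw [hF]; omega : 0 < (F i).card)
  have hper : F (i + r) = F i := by simp only [hFdef, Nat.add_mod_right]
  have hfin := (hiter r v (hper ▸ hv)).symm.trans (hi v hv)
  exact mul_right_cancel₀ hc (hfin.trans (one_mul c).symm)
end

section
/- Let k ≥ 2, let F be a k-uniform hypergraph, let ξ, ζ > 0, let c, m ∈ ℕ, and let 𝓑 ⊆ [m]^{(k−1)} be a fixed family of (k−1)-subsets of [m]. There exists n_0 (depending on ξ, ζ, |V(F)|, c, m; e.g. any n_0 with n_0 · ξ^{⌈1/ζ⌉+1} > c suffices) such that the following holds for every n ≥ n_0 and every k-uniform hypergraph H on n vertices: if for every S ⊆ V(H) with |S| ≥ c there exist a vertex v ∈ S, a set S' ⊆ S with |S'| ≥ ξ|S|, and a collection 𝓛 with |𝓛| ≥ ζ n^m such that (v, m, 𝓛, 𝓑) is an S'-nice picture for F, then H contains a copy of F. -/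
open Finset

open scoped Classical

/-- A picture `(v, m, L, B)` in the hypergraph with edge set `E`: `L` is a set of `m`-tuples of
distinct vertices avoiding `v` such that for every tuple `x ∈ L` and every `b ∈ B`, the `k`-set
`{v} ∪ x(b)` is an edge. -/
def IsPicture {n : ℕ} (E : Finset (Finset (Fin n))) (v : Fin n) (m : ℕ)
    (L : Finset (Fin m → Fin n)) (B : Finset (Finset (Fin m))) : Prop :=
  (∀ x ∈ L, Function.Injective x ∧ ∀ i, x i ≠ v) ∧
  (∀ x ∈ L, ∀ b ∈ B, insert v (b.image x) ∈ E)

/-- An `S`-nice picture for `F`: a picture such that for every `w ∈ S` and every tuple `x ∈ L`,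
adding the edges `{w} ∪ x(b)` (`b ∈ B`) to `E` creates a copy of `F`. -/
def IsNicePicture {α : Type*} {n : ℕ} (E : Finset (Finset (Fin n)))
    (F : Finset (Finset α)) (S : Finset (Fin n)) (v : Fin n) (m : ℕ)
    (L : Finset (Fin m → Fin n)) (B : Finset (Finset (Fin m))) : Prop :=
  IsPicture E v m L B ∧
  ∀ w ∈ S, ∀ x ∈ L, HasCopy F (E ∪ B.image fun b => insert w (b.image x))

theorem HasCopy.mono {α β : Type*} [DecidableEq β] {F : Finset (Finset α)}
    {E E' : Finset (Finset β)} (h : HasCopy F E) (hE : E ⊆ E') : HasCopy F E' :=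
  let ⟨f, hf, hfE⟩ := h
  ⟨f, hf, fun e he => hE (hfE e he)⟩

/-- If every large `S` carries a nice picture and there is no copy of `F`, then iterating inside `S`
yields `t` pairwise disjoint collections of tuples, all of whose links meet `S`. -/
theorem exists_large_collection {α : Type*} {n m c : ℕ} {F : Finset (Finset α)} {ξ ζ : ℝ}
    (hξ : 0 < ξ) (hξ1 : ξ ≤ 1) {B : Finset (Finset (Fin m))} {E : Finset (Finset (Fin n))}
    (hF : ¬ HasCopy F E)
    (h : ∀ S : Finset (Fin n), c ≤ S.card →
      ∃ v ∈ S, ∃ S' ⊆ S, ∃ L : Finset (Fin m → Fin n),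
        ξ * (S.card : ℝ) ≤ (S'.card : ℝ) ∧ ζ * (n : ℝ) ^ m ≤ (L.card : ℝ) ∧
        IsNicePicture E F S' v m L B)
    (t : ℕ) (S : Finset (Fin n)) (hS : (c : ℝ) ≤ ξ ^ t * S.card) :
    ∃ U : Finset (Fin m → Fin n), t * (ζ * (n : ℝ) ^ m) ≤ U.card ∧
      ∀ x ∈ U, ∃ w ∈ S, ∀ b ∈ B, insert w (b.image x) ∈ E := by
  induction t generalizing S with
  | zero => exact ⟨∅, by simp, by simp⟩
  | succ t ih =>
    have hpow : ξ ^ (t + 1) ≤ 1 := pow_le_one₀ hξ.le hξ1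
    have hcS : (c : ℝ) ≤ S.card :=
      hS.trans (mul_le_of_le_one_left (Nat.cast_nonneg _) hpow)
    obtain ⟨v, hv, S', hS', L, hcard, hL, hpic, hnice⟩ := h S (by exact_mod_cast hcS)
    obtain ⟨U, hU, hUE⟩ := ih S' (hS.trans (by
      rw [pow_succ, mul_assoc]
      exact mul_le_mul_of_nonneg_left hcard (by positivity)))
    have hdisj : Disjoint U L := by
      refine Finset.disjoint_left.2 fun x hxU hxL => hF ?_
      obtain ⟨w, hw, hwE⟩ := hUE x hxU
      refine (hnice w hw x hxL).mono (Finset.union_subset (Finset.Subset.refl _) ?_)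
      exact Finset.image_subset_iff.2 hwE
    refine ⟨U ∪ L, ?_, fun x hx => ?_⟩
    · rw [Finset.card_union_of_disjoint hdisj]
      push_cast
      linarith
    · rcases Finset.mem_union.1 hx with hx | hx
      · obtain ⟨w, hw, hwE⟩ := hUE x hx
        exact ⟨w, hS' hw, hwE⟩
      · exact ⟨v, hv, hpic.2 x hx⟩

/-- Let `k ≥ 2`, `F` a `k`-uniform hypergraph, `ξ, ζ > 0`, `c, m ∈ ℕ`, and
`B ⊆ [m]^{(k−1)}`. There exists `n₀` such that for every `n ≥ n₀` and every `k`-uniform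
hypergraph `H` on `n` vertices: if for every `S ⊆ V(H)` with `|S| ≥ c` there exist `v ∈ S`,
`S' ⊆ S` with `|S'| ≥ ξ|S|`, and a collection `L` with `|L| ≥ ζ nᵐ` such that `(v, m, L, B)` is
an `S'`-nice picture for `F`, then `H` contains a copy of `F`. -/
theorem statement14 {α : Type*} [Fintype α] (k : ℕ) (hk : 2 ≤ k)
    (F : Finset (Finset α)) (ξ ζ : ℝ) (hξ : 0 < ξ) (hζ : 0 < ζ) (c m : ℕ)
    (B : Finset (Finset (Fin m))) (hB : ∀ b ∈ B, b.card = k - 1) :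
    ∃ n₀ : ℕ, ∀ n ≥ n₀, ∀ E : Finset (Finset (Fin n)),
      (∀ e ∈ E, e.card = k) →
      (∀ S : Finset (Fin n), c ≤ S.card →
        ∃ v ∈ S, ∃ S' ⊆ S, ∃ L : Finset (Fin m → Fin n),
          ξ * (S.card : ℝ) ≤ (S'.card : ℝ) ∧ ζ * (n : ℝ) ^ m ≤ (L.card : ℝ) ∧
          IsNicePicture E F S' v m L B) →
      HasCopy F E := by
  obtain ⟨t, ht⟩ := exists_nat_gt (1 / ζ)
  rw [div_lt_iff₀ hζ] at ht
  set η := min ξ 1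
  have hη : 0 < η := lt_min hξ one_pos
  obtain ⟨N, hN⟩ := exists_nat_ge ((c : ℝ) / η ^ t)
  rw [div_le_iff₀ (by positivity)] at hN
  refine ⟨max N 1, fun n hn E _ h => ?_⟩
  by_contra hF
  have hNn : (N : ℝ) ≤ n := by exact_mod_cast (le_max_left _ _).trans hn
  have hn0 : 0 < n := (le_max_right N 1).trans hn
  obtain ⟨U, hU, -⟩ := exists_large_collection (c := c) (ζ := ζ) (B := B) hη (min_le_right _ _) hF
    (fun S hS => by
      obtain ⟨v, hv, S', hS', L, hcard, hL⟩ := h S hS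
      exact ⟨v, hv, S', hS', L,
        (mul_le_mul_of_nonneg_right (min_le_left _ _) (Nat.cast_nonneg _)).trans hcard, hL⟩)
    t Finset.univ (by
      rw [Finset.card_univ, Fintype.card_fin, mul_comm]
      exact hN.trans (mul_le_mul_of_nonneg_right hNn (by positivity)))
  have hUn : (U.card : ℝ) ≤ (n : ℝ) ^ m := by
    have := U.card_le_univ
    rw [Fintype.card_fun, Fintype.card_fin, Fintype.card_fin] at this
    exact_mod_cast this
  have hpos : (0 : ℝ) < (n : ℝ) ^ m := by positivity
  nlinarith [mul_lt_mul_of_pos_right ht hpos]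
end

section
/- For every integer ℓ ≥ 3, γ(Z_ℓ^{(3)}) ≤ 1/2; equivalently, for every ε > 0 there exists n_0 such that every 3-uniform hypergraph H on n ≥ n_0 vertices with minimum codegree δ(H) ≥ (1/2 + ε)n contains a copy of Z_ℓ^{(3)}. -/
open Finset

open scoped Classical

section Sampling

variable {V : Type*} [Fintype V] [DecidableEq V]

/-- The base of the exponential tail bound for sampling from a set of density `1 / 2 + ε`. -/
noncomputable def tailBase (ε : ℝ) : ℝ := (1 / 2 + ε) / (1 + ε) + (1 / 2 - ε) * (1 + ε)

theorem tailBase_pos {ε : ℝ} (h0 : 0 < ε) (h1 : ε ≤ 1 / 4) : 0 < tailBase ε := by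
  have : 0 ≤ (1 / 2 - ε) * (1 + ε) := mul_nonneg (by linarith) (by linarith)
  have : 0 < (1 / 2 + ε) / (1 + ε) := by positivity
  unfold tailBase
  linarith

theorem tailBase_lt_one {ε : ℝ} (h0 : 0 < ε) : tailBase ε < 1 := by
  have h : tailBase ε = 1 - (3 / 2 * ε ^ 2 + ε ^ 3) / (1 + ε) := by
    unfold tailBase
    field_simp
    ring
  have : 0 < (3 / 2 * ε ^ 2 + ε ^ 3) / (1 + ε) := by positivity
  linarith

/-- A large deviation bound: few samples of length `m` meet a set of density at least `1 / 2 + ε`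
in at most half of their entries. -/
theorem card_sparse_samples_le (A : Finset V) {ε : ℝ} (h0 : 0 < ε)
    (hA : (1 / 2 + ε) * Fintype.card V ≤ A.card) (m : ℕ) :
    ((univ.filter fun φ : Fin m → V => 2 * (univ.filter fun i => φ i ∈ A).card ≤ m).card : ℝ) ≤
      (tailBase ε * Fintype.card V) ^ m := by
  set s : ℝ := 1 + ε with hs
  have hs1 : 1 ≤ s := by linarith
  have hs0 : 0 < s := by linarith
  let w : V → ℝ := fun v => if v ∈ A then s⁻¹ else s
  have hw : ∀ v, 0 < w v := fun v => by
    simp only [w]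
    split_ifs <;> positivity
  have hsum : ∑ v, w v ≤ tailBase ε * Fintype.card V := by
    have h1 : ∑ v, w v = A.card * s⁻¹ + ((Fintype.card V : ℝ) - A.card) * s := by
      have hc : ((univ.filter fun v => v ∉ A).card : ℝ) = (Fintype.card V : ℝ) - A.card := by
        have := Finset.card_compl_add_card A
        have h2 : (univ.filter fun v => v ∉ A) = Aᶜ := by
          ext v
          simp
        rw [h2, ← this]
        push_cast
        ring
      simp only [w]
      rw [Finset.sum_ite, Finset.sum_const, Finset.sum_const, nsmul_eq_mul, nsmul_eq_mul, hc]
      simp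
    have h3 : s⁻¹ ≤ s := (inv_le_one_of_one_le₀ hs1).trans hs1
    rw [h1]
    unfold tailBase
    rw [← hs, div_eq_mul_inv]
    nlinarith [mul_le_mul_of_nonneg_right hA (sub_nonneg.2 h3)]
  calc _ = ∑ φ ∈ univ.filter (fun φ : Fin m → V =>
            2 * (univ.filter fun i => φ i ∈ A).card ≤ m), (1 : ℝ) := by simp
    _ ≤ ∑ φ ∈ univ.filter (fun φ : Fin m → V =>
            2 * (univ.filter fun i => φ i ∈ A).card ≤ m), ∏ i, w (φ i) := by
        refine Finset.sum_le_sum fun φ hφ => ?_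
        have hφ' : 2 * (univ.filter fun i => φ i ∈ A).card ≤ m := by simpa using hφ
        have hc := Finset.card_filter_add_card_filter_not (s := (univ : Finset (Fin m)))
          (fun i => φ i ∈ A)
        rw [Finset.card_univ, Fintype.card_fin] at hc
        simp only [w]
        rw [Finset.prod_ite, Finset.prod_const, Finset.prod_const, inv_pow]
        rw [inv_mul_eq_div, one_le_div (by positivity)]
        exact pow_le_pow_right₀ hs1 (by omega)
    _ ≤ ∑ φ : Fin m → V, ∏ i, w (φ i) :=
        Finset.sum_le_sum_of_subset_of_nonneg (Finset.filter_subset _ _)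
          fun φ _ _ => Finset.prod_nonneg fun i _ => (hw _).le
    _ = (∑ v, w v) ^ m := (Fintype.sum_pow _ _).symm
    _ ≤ _ := pow_le_pow_left₀ (Finset.sum_nonneg fun v _ => (hw v).le) hsum m

/-- The ordered pairs whose neighbourhood contains at most half of the entries of `φ`. -/
def sparsePairs (N : V → V → Finset V) {m : ℕ} (φ : Fin m → V) : Finset (V × V) :=
  univ.filter fun p => p.1 ≠ p.2 ∧ 2 * (univ.filter fun i => φ i ∈ N p.1 p.2).card ≤ m

theorem exists_sample [Nonempty V] (N : V → V → Finset V) {ε : ℝ} (h0 : 0 < ε)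
    (h1 : ε ≤ 1 / 4) (hN : ∀ y z, y ≠ z → (1 / 2 + ε) * Fintype.card V ≤ (N y z).card) (m : ℕ) :
    ∃ φ : Fin m → V,
      ((sparsePairs N φ).card : ℝ) ≤ tailBase ε ^ m * (Fintype.card V : ℝ) ^ 2 := by
  have hq := tailBase_pos h0 h1
  have key : ∑ φ : Fin m → V, ((sparsePairs N φ).card : ℝ) ≤
      ∑ _φ : Fin m → V, tailBase ε ^ m * (Fintype.card V : ℝ) ^ 2 := by
    have hswap : ∑ φ : Fin m → V, ((sparsePairs N φ).card : ℝ) =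
        ∑ p : V × V, ((univ.filter fun φ : Fin m → V => p.1 ≠ p.2 ∧
          2 * (univ.filter fun i => φ i ∈ N p.1 p.2).card ≤ m).card : ℝ) := by
      simp only [sparsePairs, Finset.card_filter, Nat.cast_sum]
      exact Finset.sum_comm
    rw [hswap]
    calc _ ≤ ∑ _p : V × V, (tailBase ε * Fintype.card V) ^ m := by
          refine Finset.sum_le_sum fun p _ => ?_
          by_cases hp : p.1 = p.2
          · simp only [hp, ne_eq, not_true_eq_false, false_and, Finset.filter_false,
              Finset.card_empty, Nat.cast_zero]
            positivity
          · simpa [hp] using card_sparse_samples_le (N p.1 p.2) h0 (hN _ _ hp) m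
      _ = _ := by
          simp [Finset.sum_const, Finset.card_univ, mul_pow]
          ring
  obtain ⟨φ, -, h⟩ := Finset.exists_le_of_sum_le Finset.univ_nonempty key
  exact ⟨φ, h⟩

theorem exists_vertex_few_pairs [Nonempty V] (B : Finset (V × V)) {η : ℝ}
    (hB : (B.card : ℝ) ≤ η * (Fintype.card V : ℝ) ^ 2) :
    ∃ u, ((univ.filter fun c => (u, c) ∈ B).card : ℝ) ≤ η * Fintype.card V := by
  have key : ∑ u : V, ((univ.filter fun c => (u, c) ∈ B).card : ℝ) ≤
      ∑ _u : V, η * Fintype.card V := by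
    have : ∑ u : V, ((univ.filter fun c => (u, c) ∈ B).card : ℝ) = B.card := by
      have h2 : B.card = ∑ p : V × V, if p ∈ B then 1 else 0 := by
        simp
      rw [h2, Fintype.sum_prod_type]
      simp only [Finset.card_filter, Nat.cast_sum]
    rw [this]
    simp only [Finset.sum_const, Finset.card_univ, nsmul_eq_mul]
    linarith
  obtain ⟨u, -, h⟩ := Finset.exists_le_of_sum_le Finset.univ_nonempty key
  exact ⟨u, h⟩

theorem card_le_card_inter_add (A B : Finset V) :
    A.card + B.card ≤ (A ∩ B).card + Fintype.card V := by
  have := Finset.card_union_add_card_inter A B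
  have := Finset.card_le_univ (A ∪ B)
  omega

end Sampling

section Paths

variable {V : Type*} [DecidableEq V]

/-- The pairs `{r (2 i), r (2 i + 1)}`, `i < k`, are disjoint and each of them forms an edge with
each vertex of the next one. -/
def IsPairPath (E : Finset (Finset V)) (k : ℕ) (r : ℕ → V) : Prop :=
  Set.InjOn r (Set.Iio (2 * k)) ∧ ∀ i, i + 1 < k →
    {r (2 * i), r (2 * i + 1), r (2 * i + 2)} ∈ E ∧ {r (2 * i), r (2 * i + 1), r (2 * i + 3)} ∈ E

theorem IsPairPath.extend {E : Finset (Finset V)} {k : ℕ} {r : ℕ → V}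
    (hr : IsPairPath E (k + 1) r) {a b : V} (hab : a ≠ b) (ha : ∀ i < 2 * k + 2, r i ≠ a)
    (hb : ∀ i < 2 * k + 2, r i ≠ b) (hEa : {r (2 * k), r (2 * k + 1), a} ∈ E)
    (hEb : {r (2 * k), r (2 * k + 1), b} ∈ E) :
    ∃ r' : ℕ → V, IsPairPath E (k + 2) r' ∧ (∀ i < 2 * k + 2, r' i = r i) ∧
      r' (2 * k + 2) = a ∧ r' (2 * k + 3) = b := by
  obtain ⟨hinj, hE⟩ := hr
  let r' : ℕ → V := fun i => if i = 2 * k + 2 then a else if i = 2 * k + 3 then b else r i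
  have h1 : ∀ i < 2 * k + 2, r' i = r i := fun i hi => by
    simp only [r']
    rw [if_neg (by omega), if_neg (by omega)]
  have h2 : r' (2 * k + 2) = a := by simp [r']
  have h3 : r' (2 * k + 3) = b := by simp [r']
  refine ⟨r', ⟨?_, ?_⟩, h1, h2, h3⟩
  · intro i hi j hj hij
    simp only [Set.mem_Iio] at hi hj
    have hcase : ∀ t < 2 * (k + 2), t < 2 * k + 2 ∨ t = 2 * k + 2 ∨ t = 2 * k + 3 := by
      intro t ht
      omega
    rcases hcase i hi with hi' | rfl | rfl <;> rcases hcase j hj with hj' | rfl | rfl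
    · rw [h1 i hi', h1 j hj'] at hij
      exact hinj (by simp only [Set.mem_Iio]; omega) (by simp only [Set.mem_Iio]; omega) hij
    · rw [h1 i hi', h2] at hij
      exact absurd hij (ha i hi')
    · rw [h1 i hi', h3] at hij
      exact absurd hij (hb i hi')
    · rw [h1 j hj', h2] at hij
      exact absurd hij.symm (ha j hj')
    · rfl
    · rw [h2, h3] at hij
      exact absurd hij hab
    · rw [h1 j hj', h3] at hij
      exact absurd hij.symm (hb j hj')
    · rw [h2, h3] at hij
      exact absurd hij.symm hab
    · rfl
  · intro i hi
    rcases Nat.lt_or_ge (i + 1) (k + 1) with hlt | hge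
    · rw [h1 _ (by omega), h1 _ (by omega), h1 _ (by omega), h1 _ (by omega)]
      exact hE i hlt
    · obtain rfl : i = k := by omega
      rw [h1 _ (by omega), h1 _ (by omega), h2, h3]
      exact ⟨hEa, hEb⟩

/-- The vertices that form an edge with `y` and `z`. -/
def conbr [Fintype V] (E : Finset (Finset V)) (y z : V) : Finset V :=
  univ.filter fun v => {y, z, v} ∈ E

@[simp]
theorem mem_conbr [Fintype V] {E : Finset (Finset V)} {y z v : V} :
    v ∈ conbr E y z ↔ {y, z, v} ∈ E := by
  simp [conbr]

theorem hdeg_le_card_conbr [Fintype V] {E : Finset (Finset V)} (hE : ∀ e ∈ E, e.card = 3)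
    {y z : V} (hyz : y ≠ z) : hdeg E {y, z} ≤ (conbr E y z).card := by
  unfold hdeg
  refine (Finset.card_le_card ?_).trans
    (Finset.card_image_le (s := conbr E y z) (f := fun v => ({y, z, v} : Finset V)))
  intro e he
  obtain ⟨heE, hsub⟩ := Finset.mem_filter.1 he
  have hc : (e \ {y, z}).card = 1 := by
    rw [Finset.card_sdiff_of_subset hsub, hE e heE, Finset.card_pair hyz]
  obtain ⟨v, hv⟩ := Finset.card_eq_one.1 hc
  have hev : ({y, z, v} : Finset V) = e := by
    rw [← Finset.sdiff_union_of_subset hsub, hv]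
    ext x
    simp only [Finset.mem_insert, Finset.mem_singleton, Finset.mem_union]
    tauto
  exact Finset.mem_image.2 ⟨v, by rw [mem_conbr, hev]; exact heE, hev⟩

theorem exists_isPairPath [Fintype V] {E : Finset (Finset V)} (U : Finset V) {c d : V}
    (hcd : c ≠ d) (hc : c ∉ U) (hd : d ∉ U) (k : ℕ)
    (hN : ∀ y z, y ≠ z → U.card + 2 * k + 2 ≤ (conbr E y z).card) :
    ∃ r : ℕ → V, IsPairPath E (k + 1) r ∧ r 0 = c ∧ r 1 = d ∧ ∀ i < 2 * k + 2, r i ∉ U := by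
  induction k with
  | zero =>
    refine ⟨fun i => if i = 0 then c else d, ⟨?_, fun i hi => by omega⟩, by simp, by simp, ?_⟩
    · intro i hi j hj hij
      simp only [Set.mem_Iio] at hi hj
      by_cases h1 : i = 0 <;> by_cases h2 : j = 0 <;> simp [h1, h2] at hij ⊢
      · exact absurd hij hcd
      · exact absurd hij.symm hcd
      · omega
    · intro i _
      simp only
      split_ifs <;> assumption
  | succ k ih =>
    obtain ⟨r, hr, h0, h1, hU⟩ := ih fun y z h => by have := hN y z h; omega
    have hne : r (2 * k) ≠ r (2 * k + 1) := fun h => by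
      have := hr.1 (by simp only [Set.mem_Iio]; omega) (by simp only [Set.mem_Iio]; omega) h
      omega
    set S := conbr E (r (2 * k)) (r (2 * k + 1)) \ (U ∪ (range (2 * k + 2)).image r) with hS
    have hcard : 1 < S.card := by
      have h2 := Finset.le_card_sdiff (U ∪ (range (2 * k + 2)).image r)
        (conbr E (r (2 * k)) (r (2 * k + 1)))
      have h3 := Finset.card_union_le U ((range (2 * k + 2)).image r)
      have h4 := Finset.card_image_le (s := range (2 * k + 2)) (f := r)
      rw [Finset.card_range] at h4
      have h5 := hN _ _ hne
      rw [← hS] at h2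
      omega
    obtain ⟨a, ha, b, hb, hab⟩ := Finset.one_lt_card.1 hcard
    simp only [hS, Finset.mem_sdiff, mem_conbr, Finset.mem_union, Finset.mem_image,
      Finset.mem_range, not_or, not_exists, not_and] at ha hb
    obtain ⟨r', hr', hold, h2, h3⟩ := hr.extend hab ha.2.2 hb.2.2 ha.1 hb.1
    refine ⟨r', hr', by rw [hold _ (by omega), h0], by rw [hold _ (by omega), h1], ?_⟩
    intro i hi
    rcases Nat.lt_or_ge i (2 * k + 2) with hlt | hge
    · rw [hold i hlt]
      exact hU i hlt
    · obtain rfl | rfl : i = 2 * k + 2 ∨ i = 2 * k + 3 := by omega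
      · rw [h2]
        exact ha.2.1
      · rw [h3]
        exact hb.2.1

theorem IsPairPath.hasCopy_zycle {E : Finset (Finset V)} {ℓ : ℕ} {r : ℕ → V}
    (hr : IsPairPath E (ℓ + 1) r) (h0 : {r (2 * ℓ), r (2 * ℓ + 1), r 0} ∈ E)
    (h1 : {r (2 * ℓ), r (2 * ℓ + 1), r 1} ∈ E) : HasCopy (zycle 3 (ℓ + 1)) E := by
  refine ⟨fun p => r (2 * p.1.val + p.2.val), ?_, ?_⟩
  · rintro ⟨i, j⟩ ⟨i', j'⟩ h
    have hj := j.isLt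
    have hj' := j'.isLt
    have hi := i.isLt
    have hi' := i'.isLt
    have := hr.1 (by simp only [Set.mem_Iio]; omega) (by simp only [Set.mem_Iio]; omega) h
    dsimp only at this
    simp only [Prod.mk.injEq, Fin.ext_iff]
    omega
  · intro e he
    obtain ⟨⟨i, j⟩, -, rfl⟩ := Finset.mem_image.1 he
    have himg : ∀ x : V, insert x ({r (2 * i.val), r (2 * i.val + 1)} : Finset V) =
        {r (2 * i.val), r (2 * i.val + 1), x} := fun x => by
      ext y
      simp only [Finset.mem_insert, Finset.mem_singleton]
      tauto
    have hu : (univ : Finset (Fin (3 - 1))) = {0, 1} := rfl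
    rw [Finset.image_insert, Finset.image_image, hu, Finset.image_insert, Finset.image_singleton]
    simp only [Function.comp_apply]
    have e0 : ((0 : Fin (3 - 1)) : ℕ) = 0 := rfl
    have e1 : ((1 : Fin (3 - 1)) : ℕ) = 1 := rfl
    rw [e0, e1, add_zero, himg]
    have hj : j.val = 0 ∨ j.val = 1 := by have := j.isLt; omega
    rcases Nat.lt_or_ge (i.val + 1) (ℓ + 1) with hlt | hge
    · rw [Nat.mod_eq_of_lt hlt]
      have := hr.2 i.val hlt
      rcases hj with hj | hj <;> rw [hj]
      · exact this.1
      · exact this.2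
    · have hi : i.val = ℓ := by have := i.isLt; omega
      rw [hi, Nat.mod_self]
      rcases hj with hj | hj <;> rw [hj]
      · exact h0
      · exact h1

end Paths

section Main

variable {V : Type*} [Fintype V] [DecidableEq V]

/-- Two vertices outside `U` with the same dense trace on the sample `φ` in the link of `u`. -/
theorem exists_twins (N : V → V → Finset V) {m : ℕ} (φ : Fin m → V) (u : V) (U : Finset V)
    (hu : u ∈ U)
    (hcard : U.card + (univ.filter fun c => (u, c) ∈ sparsePairs N φ).card + 2 ^ m <
      Fintype.card V) :
    ∃ c d, c ≠ d ∧ c ∉ U ∧ d ∉ U ∧ m < 2 * (univ.filter fun i => φ i ∈ N u c).card ∧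
      ∀ i, φ i ∈ N u c ↔ φ i ∈ N u d := by
  set B := univ.filter fun c => (u, c) ∈ sparsePairs N φ with hB
  have h1 : (univ : Finset (Finset (Fin m))).card < ((U ∪ B)ᶜ).card := by
    have := Finset.card_compl_add_card (U ∪ B)
    have := Finset.card_union_le U B
    rw [Finset.card_univ, Fintype.card_finset, Fintype.card_fin]
    omega
  obtain ⟨c, hc, d, hd, hcd, h⟩ := Finset.exists_ne_map_eq_of_card_lt_of_maps_to h1
    (f := fun c => univ.filter fun i => φ i ∈ N u c) (fun _ _ => Finset.mem_coe.2 (mem_univ _))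
  simp only [Finset.mem_compl, Finset.mem_union, not_or] at hc hd
  refine ⟨c, d, hcd, hc.1, hd.1, ?_, fun i => ?_⟩
  · by_contra hlt
    refine hc.2 ?_
    simp only [hB, sparsePairs, Finset.mem_filter, Finset.mem_univ, true_and]
    exact ⟨fun h => hc.1 (h ▸ hu), not_lt.1 hlt⟩
  · simpa using Finset.ext_iff.1 h i

/-- If `F` is a set of more than half of the vertices, then many edges at `u` have their two other
vertices in `F`, so one of these pairs avoids a small set of vertices and a sparse set of pairs. -/
theorem exists_pair_of_dense {E : Finset (Finset V)} {ε : ℝ} (h0 : 0 < ε)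
    (hN : ∀ y z, y ≠ z → (1 / 2 + ε) * Fintype.card V ≤ (conbr E y z).card)
    (u : V) (U : Finset V) (hu : u ∈ U) (F : Finset V)
    (hF : (1 / 2 + ε) * Fintype.card V ≤ F.card) (B : Finset (V × V))
    (hB : (B.card : ℝ) ≤ ε / 4 * (Fintype.card V : ℝ) ^ 2)
    (hU : (U.card : ℝ) ≤ ε * Fintype.card V) (hU' : 4 * (U.card : ℝ) < Fintype.card V) :
    ∃ y ∈ F, ∃ z ∈ F, y ∉ U ∧ z ∉ U ∧ {u, y, z} ∈ E ∧ (y, z) ∉ B := by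
  by_contra! hcon
  set n : ℝ := (Fintype.card V : ℝ) with hn
  have hn0 : 0 < n := lt_of_le_of_lt (by positivity) hU'
  let S : V → Finset V := fun y => (F ∩ conbr E u y) \ U
  have hsub : (F \ U).sigma S ⊆ (B.map (Equiv.sigmaEquivProd V V).symm.toEmbedding) := by
    rintro ⟨y, z⟩ hyz
    simp only [S, Finset.mem_sigma, Finset.mem_sdiff, Finset.mem_inter, mem_conbr] at hyz
    have := hcon y hyz.1.1 z hyz.2.1.1 hyz.1.2 hyz.2.2 hyz.2.1.2
    exact Finset.mem_map.2 ⟨(y, z), this, rfl⟩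
  have hle := Finset.card_le_card hsub
  rw [Finset.card_map, Finset.card_sigma] at hle
  have hle' : ∑ y ∈ F \ U, ((S y).card : ℝ) ≤ B.card := by exact_mod_cast hle
  have hS : ∀ y ∈ F \ U, ε * n ≤ ((S y).card : ℝ) := by
    intro y hy
    have hyu : u ≠ y := fun h => (Finset.mem_sdiff.1 hy).2 (h ▸ hu)
    have h1 := hN u y hyu
    have h2 : (F.card : ℝ) + (conbr E u y).card ≤ (F ∩ conbr E u y).card + n := by
      rw [hn]
      exact_mod_cast card_le_card_inter_add F (conbr E u y)
    have h3 : ((F ∩ conbr E u y).card : ℝ) ≤ (S y).card + U.card := by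
      have := Finset.le_card_sdiff U (F ∩ conbr E u y)
      have h4 : (F ∩ conbr E u y).card ≤ (S y).card + U.card := by
        simp only [S]
        omega
      exact_mod_cast h4
    linarith
  have hsum := Finset.card_nsmul_le_sum _ _ _ hS
  rw [nsmul_eq_mul] at hsum
  have hFU : (F.card : ℝ) ≤ (F \ U).card + U.card := by
    have := Finset.le_card_sdiff U F
    have h4 : F.card ≤ (F \ U).card + U.card := by omega
    exact_mod_cast h4
  have hεn : 0 < ε * n := by positivity
  have h5 : n / 4 < ((F \ U).card : ℝ) := by nlinarith
  nlinarith [mul_lt_mul_of_pos_right h5 hεn]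

theorem hasCopy_zycle_of_codegree {E : Finset (Finset V)} (hE : ∀ e ∈ E, e.card = 3) {ε : ℝ}
    (h0 : 0 < ε) (h1 : ε ≤ 1 / 4)
    (hN : ∀ y z, y ≠ z → (1 / 2 + ε) * Fintype.card V ≤ (conbr E y z).card) (k m : ℕ)
    (hm : tailBase ε ^ m ≤ ε / 4)
    (hn : (2 ^ m + m + 2 * k + 4 : ℝ) / ε < Fintype.card V) :
    HasCopy (zycle 3 (k + 3)) E := by
  set n : ℝ := (Fintype.card V : ℝ) with hnn
  have hK : (2 ^ m + m + 2 * k + 4 : ℝ) < ε * n := by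
    rwa [div_lt_iff₀' h0] at hn
  have hn0 : 0 < n := lt_of_le_of_lt (by positivity) hn
  have hεn : ε * n ≤ n / 4 := by nlinarith
  have hV : Nonempty V := by
    rw [← Fintype.card_pos_iff]
    rw [hnn] at hn0
    exact_mod_cast hn0
  have h2m : (0 : ℝ) < 2 ^ m := by positivity
  obtain ⟨φ, hφ⟩ := exists_sample (conbr E) h0 h1 hN m
  have hB : ((sparsePairs (conbr E) φ).card : ℝ) ≤ ε / 4 * n ^ 2 :=
    hφ.trans (mul_le_mul_of_nonneg_right hm (by positivity))
  obtain ⟨u, hu⟩ := exists_vertex_few_pairs _ hB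
  set U : Finset V := insert u (univ.image φ) with hUdef
  have hφU : ∀ i, φ i ∈ U := fun i =>
    Finset.mem_insert_of_mem (Finset.mem_image_of_mem _ (mem_univ i))
  have huU : u ∈ U := Finset.mem_insert_self _ _
  have hUc : U.card ≤ m + 1 := by
    refine (Finset.card_insert_le _ _).trans ?_
    have := Finset.card_image_le (s := (univ : Finset (Fin m))) (f := φ)
    rw [Finset.card_univ, Fintype.card_fin] at this
    omega
  have hUcR : (U.card : ℝ) ≤ m + 1 := by exact_mod_cast hUc
  obtain ⟨c, d, hcd, hc, hd, hdense, htwin⟩ := exists_twins (conbr E) φ u U huU (by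
    have : (U.card : ℝ) + ((univ.filter fun c => (u, c) ∈ sparsePairs (conbr E) φ).card : ℝ) +
        2 ^ m < n := by
      nlinarith [(Nat.cast_nonneg k : (0 : ℝ) ≤ k)]
    rw [hnn] at this
    exact_mod_cast this)
  obtain ⟨r, hr, hr0, hr1, hrU⟩ := exists_isPairPath (E := E) U hcd hc hd k (by
    intro y z hyz
    have h := hN y z hyz
    have : (U.card : ℝ) + 2 * k + 2 ≤ ((conbr E y z).card : ℝ) := by nlinarith
    exact_mod_cast this)
  have hne : r (2 * k) ≠ r (2 * k + 1) := fun h => by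
    have := hr.1 (by simp only [Set.mem_Iio]; omega) (by simp only [Set.mem_Iio]; omega) h
    omega
  set U' := U ∪ (range (2 * k + 2)).image r with hU'
  have hU'c : (U'.card : ℝ) ≤ m + 2 * k + 3 := by
    have h3 := Finset.card_union_le U ((range (2 * k + 2)).image r)
    have h4 := Finset.card_image_le (s := range (2 * k + 2)) (f := r)
    rw [Finset.card_range] at h4
    rw [← hU'] at h3
    have : U'.card ≤ m + 2 * k + 3 := by omega
    exact_mod_cast this
  obtain ⟨y, hy, z, hz, hyU, hzU, huyz, hyzB⟩ := exists_pair_of_dense h0 hN u U'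
    (Finset.mem_union_left _ huU) _ (hN _ _ hne) _ hB (by linarith) (by linarith)
  rw [mem_conbr] at hy hz
  have hyzne : y ≠ z := (Finset.card_triple_eq_three_iff.1 (hE _ huyz)).2.2
  have hdense' : m < 2 * (univ.filter fun i => φ i ∈ conbr E y z).card := by
    by_contra hlt
    refine hyzB ?_
    simp only [sparsePairs, Finset.mem_filter, Finset.mem_univ, true_and]
    exact ⟨hyzne, not_lt.1 hlt⟩
  obtain ⟨i, hi⟩ : ((univ.filter fun i => φ i ∈ conbr E u c) ∩
      (univ.filter fun i => φ i ∈ conbr E y z)).Nonempty := by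
    have := card_le_card_inter_add (univ.filter fun i => φ i ∈ conbr E u c)
      (univ.filter fun i => φ i ∈ conbr E y z)
    rw [Fintype.card_fin] at this
    rw [← Finset.card_pos]
    omega
  simp only [Finset.mem_inter, Finset.mem_filter, Finset.mem_univ, true_and] at hi
  have hucw := mem_conbr.1 hi.1
  have hudw := mem_conbr.1 ((htwin i).1 hi.1)
  have hyzw := mem_conbr.1 hi.2
  have hwU := hφU i
  generalize φ i = w at hucw hudw hyzw hwU
  have huw : u ≠ w := (Finset.card_triple_eq_three_iff.1 (hE _ hucw)).2.1
  simp only [hU', Finset.mem_union, Finset.mem_image, Finset.mem_range, not_or, not_exists,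
    not_and] at hyU hzU
  obtain ⟨r₁, hr₁, hold₁, hy₁, hz₁⟩ := hr.extend hyzne hyU.2 hzU.2 hy hz
  have havoid : ∀ i < 2 * (k + 1) + 2, r₁ i ∉ U := by
    intro i hi
    rcases Nat.lt_or_ge i (2 * k + 2) with hlt | hge
    · rw [hold₁ i hlt]
      exact hrU i hlt
    · obtain rfl | rfl : i = 2 * k + 2 ∨ i = 2 * k + 3 := by omega
      · rw [hy₁]
        exact hyU.1
      · rw [hz₁]
        exact hzU.1
  obtain ⟨r₂, hr₂, hold₂, hu₂, hw₂⟩ := hr₁.extend huw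
    (fun i hi h => havoid i hi (h ▸ huU)) (fun i hi h => havoid i hi (h ▸ hwU))
    (by
      rw [show 2 * (k + 1) = 2 * k + 2 by ring, hy₁, hz₁]
      rwa [Finset.insert_comm, Finset.pair_comm] at huyz)
    (by rwa [show 2 * (k + 1) = 2 * k + 2 by ring, hy₁, hz₁])
  refine hr₂.hasCopy_zycle ?_ ?_
  · rw [show 2 * (k + 1 + 1) = 2 * (k + 1) + 2 by ring, hu₂, hw₂, hold₂ 0 (by omega),
      hold₁ 0 (by omega), hr0, Finset.pair_comm]
    exact hucw
  · rw [show 2 * (k + 1 + 1) = 2 * (k + 1) + 2 by ring, hu₂, hw₂, hold₂ 1 (by omega),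
      hold₁ 1 (by omega), hr1, Finset.pair_comm]
    exact hudw

theorem hasCopy_zycle_of_hdeg {ℓ : ℕ} (hℓ : 3 ≤ ℓ) {ε : ℝ} (hε : 0 < ε) :
    ∃ n₀ : ℕ, ∀ n ≥ n₀, ∀ E : Finset (Finset (Fin n)), (∀ e ∈ E, e.card = 3) →
      (∀ s : Finset (Fin n), s.card = 2 → (1 / 2 + ε) * n ≤ (hdeg E s : ℝ)) →
      HasCopy (zycle 3 ℓ) E := by
  obtain ⟨k, rfl⟩ := Nat.exists_eq_add_of_le' hℓ
  set δ := min ε (1 / 4) with hδ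
  have h0 : 0 < δ := lt_min hε (by norm_num)
  have h1 : δ ≤ 1 / 4 := min_le_right _ _
  obtain ⟨m, hm⟩ := exists_pow_lt_of_lt_one (show 0 < δ / 4 by positivity) (tailBase_lt_one h0)
  obtain ⟨n₀, hn₀⟩ := exists_nat_gt ((2 ^ m + m + 2 * k + 4 : ℝ) / δ)
  refine ⟨n₀, fun n hn E hE hdegE => hasCopy_zycle_of_codegree hE h0 h1 ?_ k m hm.le ?_⟩
  · intro y z hyz
    have h2 := hdegE {y, z} (Finset.card_pair hyz)
    have h3 : (hdeg E {y, z} : ℝ) ≤ (conbr E y z).card := by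
      exact_mod_cast hdeg_le_card_conbr hE hyz
    have h4 : (1 / 2 + δ) * (n : ℝ) ≤ (1 / 2 + ε) * n := by
      gcongr
      exact min_le_left _ _
    rw [Fintype.card_fin]
    linarith
  · rw [Fintype.card_fin]
    exact hn₀.trans_le (by exact_mod_cast hn)

/-- An asymptotic codegree condition forcing `F` bounds the codegree density of `F`. -/
theorem codegTuranDensity_le {α : Type*} {k : ℕ} {F : Finset (Finset α)} {γ : ℝ} (hγ : 0 ≤ γ)
    (h : ∀ ε : ℝ, 0 < ε → ∃ n₀ : ℕ, ∀ n ≥ n₀, ∀ E : Finset (Finset (Fin n)),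
      (∀ e ∈ E, e.card = k) →
      (∀ s : Finset (Fin n), s.card = k - 1 → (γ + ε) * n ≤ (hdeg E s : ℝ)) → HasCopy F E) :
    codegTuranDensity k F ≤ γ := by
  refine le_of_forall_pos_le_add fun ε hε => ?_
  obtain ⟨n₀, hn₀⟩ := h ε hε
  refine Filter.limsup_le_of_le
    (Filter.isCoboundedUnder_le_of_le _ (x := 0) fun n => by positivity) ?_
  filter_upwards [Filter.eventually_ge_atTop n₀] with n hn
  refine div_le_of_le_mul₀ (by positivity) (by positivity) ?_
  have hfloor : exco k n F ≤ ⌊(γ + ε) * n⌋₊ := by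
    refine csSup_le' ?_
    rintro d ⟨E, hE, hfree, hd⟩
    refine Nat.le_floor (le_of_not_ge fun hle => hfree (hn₀ n hn E hE fun s hs => ?_))
    exact hle.trans (by exact_mod_cast hd s hs)
  exact (Nat.le_floor_iff (by positivity)).1 hfloor

end Main

/-- For every integer `ℓ ≥ 3`, `γ(Z_ℓ^{(3)}) ≤ 1/2`; equivalently, for every
`ε > 0` there exists `n₀` such that every 3-uniform hypergraph `H` on `n ≥ n₀` vertices with
minimum codegree `δ(H) ≥ (1/2 + ε)n` contains a copy of `Z_ℓ^{(3)}`. -/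
theorem statement15 (ℓ : ℕ) (hℓ : 3 ≤ ℓ) :
    codegTuranDensity 3 (zycle 3 ℓ) ≤ 1 / 2 ∧
    ∀ ε : ℝ, 0 < ε → ∃ n₀ : ℕ, ∀ n ≥ n₀, ∀ E : Finset (Finset (Fin n)),
      (∀ e ∈ E, e.card = 3) →
      (∀ s : Finset (Fin n), s.card = 2 → (1 / 2 + ε) * n ≤ (hdeg E s : ℝ)) →
      HasCopy (zycle 3 ℓ) E := by
  have h : ∀ ε : ℝ, 0 < ε → _ := fun ε hε => hasCopy_zycle_of_hdeg hℓ hε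
  exact ⟨codegTuranDensity_le (by norm_num) h, h⟩
end

section
/- Let k ≥ 3 be an integer and p > k a prime. Then there exists an integer ℓ with 2 ≤ ℓ ≤ p−1 such that the k-uniform hypergraph F̃_p^{(k)} contains a copy of the zycle Z_ℓ^{(k)} (namely, ℓ is the multiplicative order of 1−k modulo p, and the classes V_1 ▷ V_{1−k} ▷ ⋯ ▷ V_{(1−k)^{ℓ−1}} form the zycle). Consequently, γ(F̃_p^{(k)}) ≥ 1/(2(k−1)^p) > 0. -/
open Finset

open scoped Classical

/-- The k-graph `F̃_p^{(k)}`: vertices are `Fin p × Fin (k-1)` (p clusters of size `k−1`,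
cluster of `v` indexed by the residue `𝔣(v) = v.1` in `ZMod p`); a `k`-set is an edge iff its
`𝔣`-values sum to `0 mod p`. -/
noncomputable def ftildeEdges (k p : ℕ) : Finset (Finset (Fin p × Fin (k - 1))) :=
  Finset.univ.filter fun e : Finset (Fin p × Fin (k - 1)) =>
    e.card = k ∧ ∑ v ∈ e, ((v.1 : ℕ) : ZMod p) = 0

/-- The successor of `i` in the cyclic order on `Fin ℓ`. -/
def cyclicSucc {ℓ : ℕ} (i : Fin ℓ) : Fin ℓ :=
  ⟨(i.val + 1) % ℓ, Nat.mod_lt _ i.pos⟩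

theorem cyclicSucc_ne {ℓ : ℕ} (hℓ : 2 ≤ ℓ) (i : Fin ℓ) : cyclicSucc i ≠ i := by
  intro h
  have h' : (i.val + 1) % ℓ = i.val := congrArg Fin.val h
  have hi := i.isLt
  rcases Nat.lt_or_ge (i.val + 1) ℓ with h1 | h1
  · rw [Nat.mod_eq_of_lt h1] at h'
    omega
  · have h2 : i.val + 1 = ℓ := by omega
    rw [h2, Nat.mod_self] at h'
    omega

/-- The edge of the zycle consisting of the `i`-th cluster and the `j`-th vertex of the next one. -/
def zycleEdge (k ℓ : ℕ) (i : Fin ℓ) (j : Fin (k - 1)) : Finset (Fin ℓ × Fin (k - 1)) :=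
  insert (cyclicSucc i, j) (Finset.univ.image fun j' : Fin (k - 1) => (i, j'))

theorem mem_zycle {k ℓ : ℕ} {e : Finset (Fin ℓ × Fin (k - 1))} :
    e ∈ zycle k ℓ ↔ ∃ i j, zycleEdge k ℓ i j = e := by
  simp [zycle, zycleEdge, cyclicSucc]

theorem card_zycleEdge {k ℓ : ℕ} (hk : 1 ≤ k) (hℓ : 2 ≤ ℓ) (i : Fin ℓ) (j : Fin (k - 1)) :
    (zycleEdge k ℓ i j).card = k := by
  rw [zycleEdge, Finset.card_insert_of_notMem, Finset.card_image_of_injective, Finset.card_univ,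
    Fintype.card_fin]
  · omega
  · exact Prod.mk_right_injective i
  · simp [(cyclicSucc_ne hℓ i).symm]

theorem sum_zycleEdge {k ℓ : ℕ} (hℓ : 2 ≤ ℓ) (i : Fin ℓ) (j : Fin (k - 1))
    {M : Type*} [AddCommMonoid M] (L : Fin ℓ × Fin (k - 1) → M) :
    ∑ v ∈ zycleEdge k ℓ i j, L v = L (cyclicSucc i, j) + ∑ j', L (i, j') := by
  rw [zycleEdge, Finset.sum_insert, Finset.sum_image]
  · exact (Prod.mk_right_injective i).injOn
  · simp [(cyclicSucc_ne hℓ i).symm]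

theorem HasCopy.trans {α β δ : Type*} [DecidableEq β] [DecidableEq δ] {F : Finset (Finset α)}
    {G : Finset (Finset β)} {H : Finset (Finset δ)} (h₁ : HasCopy F G) (h₂ : HasCopy G H) :
    HasCopy F H := by
  obtain ⟨f, hf, hfe⟩ := h₁
  obtain ⟨g, hg, hge⟩ := h₂
  refine ⟨g ∘ f, hg.comp hf, fun e he => ?_⟩
  rw [← Finset.image_image]
  exact hge _ (hfe e he)

/-- The zycle whose length is the multiplicative order of `1 - k` modulo `p` embeds into
`F̃_p^{(k)}`. -/
theorem hasCopy_zycle_ftildeEdges {k p : ℕ} [NeZero p] (hk : 1 ≤ k)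
    (hℓ : 2 ≤ orderOf (1 - k : ZMod p)) :
    HasCopy (zycle k (orderOf (1 - k : ZMod p))) (ftildeEdges k p) := by
  set x : ZMod p := 1 - k with hx
  have hval : ∀ a : ZMod p, ((a.val : ℕ) : ZMod p) = a := ZMod.natCast_zmod_val
  let f : Fin (orderOf x) × Fin (k - 1) → Fin p × Fin (k - 1) :=
    fun v => (⟨(x ^ v.1.val).val, ZMod.val_lt _⟩, v.2)
  have hf : Function.Injective f := by
    rintro ⟨i, j⟩ ⟨i', j'⟩ h
    simp only [f, Prod.mk.injEq, Fin.mk.injEq] at h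
    have h1 := ZMod.val_injective p h.1
    have h2 := pow_injOn_Iio_orderOf i.isLt i'.isLt h1
    exact Prod.ext (Fin.ext h2) h.2
  refine ⟨f, hf, fun e he => ?_⟩
  obtain ⟨i, j, rfl⟩ := mem_zycle.1 he
  simp only [ftildeEdges, Finset.mem_filter, Finset.mem_univ, true_and]
  rw [Finset.card_image_of_injective _ hf, card_zycleEdge hk hℓ, Finset.sum_image hf.injOn,
    sum_zycleEdge hℓ]
  refine ⟨rfl, ?_⟩
  simp only [f, hval, Finset.sum_const, Finset.card_univ, Fintype.card_fin, cyclicSucc,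
    pow_mod_orderOf, nsmul_eq_mul]
  have hkx : ((k - 1 : ℕ) : ZMod p) = -x := by
    rw [Nat.cast_sub hk, Nat.cast_one, hx, neg_sub]
  rw [hkx, pow_succ]
  ring

/-- The `k`-graph on `Fin n` whose edges are the `k`-sets with sum congruent to `1` modulo `m`. -/
noncomputable def sumEdges (k m n : ℕ) : Finset (Finset (Fin n)) :=
  Finset.univ.filter fun e => e.card = k ∧ ∑ v ∈ e, ((v : ℕ) : ZMod m) = 1

theorem hasCopy_zycle_sumEdges {k ℓ m n : ℕ} (hk : 2 ≤ k) (hℓ : 2 ≤ ℓ)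
    (hm : (m : ℤ) ∣ (1 - k : ℤ) ^ ℓ - 1) (h : HasCopy (zycle k ℓ) (sumEdges k m n)) :
    (m : ℤ) ∣ ∑ i ∈ Finset.range ℓ, (1 - k : ℤ) ^ i := by
  obtain ⟨g, hg, hge⟩ := h
  have key : ∀ i j, ((g (cyclicSucc i, j) : ℕ) : ZMod m) + ∑ j', ((g (i, j') : ℕ) : ZMod m) = 1 := by
    intro i j
    have := hge _ (mem_zycle.2 ⟨i, j, rfl⟩)
    simp only [sumEdges, Finset.mem_filter, Finset.mem_univ, true_and] at this
    rw [Finset.sum_image hg.injOn, sum_zycleEdge hℓ i j fun v => ((g v : ℕ) : ZMod m)] at this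
    exact this.2
  let s : Fin ℓ → ZMod m := fun i => ∑ j', ((g (i, j') : ℕ) : ZMod m)
  let y : Fin ℓ → ZMod m := fun i => 1 - s i
  have hs : ∀ i, y (cyclicSucc i) = 1 + (1 - k) * y i := by
    intro i
    have hc : s (cyclicSucc i) = ((k - 1 : ℕ) : ZMod m) * y i := by
      simp only [s]
      rw [Finset.sum_congr rfl fun j _ => eq_sub_of_add_eq (key i j)]
      simp [y, s, mul_sub]
    simp only [y] at hc ⊢
    rw [hc, Nat.cast_sub (by omega)]
    push_cast
    ring
  have hiter : ∀ t : ℕ, y ⟨t % ℓ, Nat.mod_lt _ (by omega)⟩ =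
      ∑ i ∈ Finset.range t, (1 - k : ZMod m) ^ i + (1 - k) ^ t * y ⟨0, by omega⟩ := by
    intro t
    induction t with
    | zero => simp
    | succ t ih =>
      have h1 := hs ⟨t % ℓ, Nat.mod_lt _ (by omega)⟩
      have h2 : cyclicSucc (⟨t % ℓ, Nat.mod_lt _ (by omega)⟩ : Fin ℓ) =
          ⟨(t + 1) % ℓ, Nat.mod_lt _ (by omega)⟩ := by
        simp [cyclicSucc]
      rw [h2, ih] at h1
      rw [h1, geom_sum_succ]
      ring
  have hfin := hiter ℓ
  have hpow : (1 - k : ZMod m) ^ ℓ = 1 := by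
    have := (ZMod.intCast_zmod_eq_zero_iff_dvd _ _).2 hm
    push_cast at this
    exact sub_eq_zero.1 this
  simp only [Nat.mod_self] at hfin
  rw [hpow, one_mul, eq_comm, add_eq_right] at hfin
  rw [← ZMod.intCast_zmod_eq_zero_iff_dvd]
  push_cast
  exact hfin

theorem div_le_card_natCast_eq {m : ℕ} [NeZero m] (n : ℕ) (a : ZMod m) :
    n / m ≤ (Finset.univ.filter fun v : Fin n => ((v : ℕ) : ZMod m) = a).card := by
  have hm : 0 < m := NeZero.pos m
  have hlt : ∀ q : Fin (n / m), a.val + m * q.val < n := by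
    intro q
    have h1 : m * (q.val + 1) ≤ m * (n / m) := Nat.mul_le_mul_left _ q.isLt
    have h2 := Nat.mul_div_le n m
    have h3 := ZMod.val_lt a
    rw [mul_add] at h1
    omega
  calc n / m = (Finset.univ : Finset (Fin (n / m))).card := by simp
    _ ≤ _ := by
      refine Finset.card_le_card_of_injOn (fun q => ⟨a.val + m * q.val, hlt q⟩) ?_ ?_
      · intro q _
        simp
      · intro q _ q' _ h
        simp only [Fin.mk.injEq, Nat.add_left_cancel_iff] at h
        exact Fin.ext (Nat.eq_of_mul_eq_mul_left hm h)

theorem le_hdeg_sumEdges {k m n : ℕ} [NeZero m] (hk : 1 ≤ k) {s : Finset (Fin n)}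
    (hs : s.card = k - 1) : n / m - (k - 1) ≤ hdeg (sumEdges k m n) s := by
  set A := Finset.univ.filter fun v : Fin n =>
    ((v : ℕ) : ZMod m) = 1 - ∑ v ∈ s, ((v : ℕ) : ZMod m) with hA
  calc n / m - (k - 1) ≤ A.card - s.card :=
        hs ▸ Nat.sub_le_sub_right (div_le_card_natCast_eq n _) _
    _ ≤ (A \ s).card := Finset.le_card_sdiff s A
    _ ≤ hdeg (sumEdges k m n) s := by
      refine Finset.card_le_card_of_injOn (fun v => insert v s) ?_ ?_
      · intro v hv
        have hv' := Finset.mem_sdiff.1 hv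
        have hv1 := (Finset.mem_filter.1 hv'.1).2
        simp only [sumEdges, Finset.coe_filter, Finset.mem_filter, Finset.mem_univ, true_and,
          Set.mem_ofPred_eq]
        refine ⟨⟨?_, ?_⟩, Finset.subset_insert _ _⟩
        · rw [Finset.card_insert_of_notMem hv'.2, hs]
          omega
        · rw [Finset.sum_insert hv'.2, hv1]
          ring
      · intro v hv w _ h
        have hv' := (Finset.mem_sdiff.1 hv).2
        have : v ∈ insert w s := by
          rw [← show insert v s = insert w s from h]
          exact Finset.mem_insert_self v s
        exact (Finset.mem_insert.1 this).resolve_right hv'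

theorem hdeg_le {k n : ℕ} {E : Finset (Finset (Fin n))} (hE : ∀ e ∈ E, e.card = k) (hk : 1 ≤ k)
    {s : Finset (Fin n)} (hs : s.card = k - 1) : hdeg E s ≤ n := by
  calc hdeg E s ≤ (Finset.univ.image fun v => insert v s).card := by
        refine Finset.card_le_card fun e he => ?_
        obtain ⟨heE, hse⟩ := Finset.mem_filter.1 he
        obtain ⟨v, _, hv⟩ := (Finset.exists_eq_insert_iff (s := s) (t := e)).2
          ⟨hse, by rw [hE e heE, hs]; omega⟩
        exact Finset.mem_image.2 ⟨v, Finset.mem_univ _, hv⟩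
    _ ≤ (Finset.univ : Finset (Fin n)).card := Finset.card_image_le
    _ = n := by simp

theorem mem_upperBounds_codegree {α : Type*} {k n : ℕ} (hk : 1 ≤ k) (hn : k - 1 ≤ n)
    (F : Finset (Finset α)) :
    n ∈ upperBounds {d : ℕ | ∃ E : Finset (Finset (Fin n)), (∀ e ∈ E, e.card = k) ∧
      ¬ HasCopy F E ∧ ∀ s : Finset (Fin n), s.card = k - 1 → d ≤ hdeg E s} := by
  rintro d ⟨E, hE, -, hd⟩
  obtain ⟨s, -, hs⟩ := Finset.exists_subset_card_eq (s := (Finset.univ : Finset (Fin n)))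
    (n := k - 1) (by simpa using hn)
  exact (hd s hs).trans (hdeg_le hE hk hs)

theorem exco_le {α : Type*} {k n : ℕ} (hk : 1 ≤ k) (hn : k - 1 ≤ n) (F : Finset (Finset α)) :
    exco k n F ≤ n :=
  csSup_le' (mem_upperBounds_codegree hk hn F)

theorem le_exco {α : Type*} {k m n : ℕ} [NeZero m] (hk : 1 ≤ k) (hn : k - 1 ≤ n)
    {F : Finset (Finset α)} (hF : ¬ HasCopy F (sumEdges k m n)) :
    n / m - (k - 1) ≤ exco k n F :=
  le_csSup ⟨n, mem_upperBounds_codegree hk hn F⟩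
    ⟨sumEdges k m n, fun _ he => (Finset.mem_filter.1 he).2.1, hF,
      fun _ hs => le_hdeg_sumEdges hk hs⟩

theorem le_codegTuranDensity {α : Type*} {k m : ℕ} [NeZero m] (hk : 1 ≤ k)
    {F : Finset (Finset α)} (hF : ∀ n, ¬ HasCopy F (sumEdges k m n)) {b : ℝ}
    (hb : b < 1 / m) : b ≤ codegTuranDensity k F := by
  have hm : (0 : ℝ) < m := Nat.cast_pos.2 (NeZero.pos m)
  have hlarge := tendsto_natCast_atTop_atTop (R := ℝ) |>.eventually_ge_atTop (k / (1 / m - b))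
  refine Filter.le_limsup_of_frequently_le (Filter.Eventually.frequently ?_) ?_
  · filter_upwards [hlarge, Filter.eventually_ge_atTop k] with n hn hkn
    have hn0 : (0 : ℝ) < n := by exact_mod_cast (by omega : 0 < n)
    have h1 : (n : ℝ) / m < ((n / m : ℕ) : ℝ) + 1 := by
      rw [div_lt_iff₀ hm]
      exact_mod_cast Nat.lt_mul_of_div_lt (Nat.lt_succ_self _) (NeZero.pos m)
    have h2 : n / m + 1 ≤ exco k n F + k := by
      have := le_exco (m := m) hk (by omega) (hF n)
      omega
    have h3 : ((n / m : ℕ) : ℝ) + 1 ≤ exco k n F + k := by exact_mod_cast h2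
    rw [div_le_iff₀ (sub_pos.2 hb)] at hn
    rw [le_div_iff₀ hn0]
    have h4 : (n : ℝ) * (1 / m - b) = n / m - b * n := by ring
    linarith
  · refine Filter.isBoundedUnder_of_eventually_le (a := 1) ?_
    filter_upwards [Filter.eventually_ge_atTop k] with n hkn
    exact div_le_one_of_le₀ (by exact_mod_cast exco_le hk (by omega) F) n.cast_nonneg

theorem two_le_orderOf_one_sub {k p : ℕ} [Fact p.Prime] (hk : 2 ≤ k) (hkp : k < p) :
    2 ≤ orderOf (1 - k : ZMod p) ∧ orderOf (1 - k : ZMod p) ≤ p - 1 := by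
  have hcast : ∀ a : ℕ, 0 < a → a < p → (a : ZMod p) ≠ 0 := fun a h0 h1 h =>
    Nat.not_dvd_of_pos_of_lt h0 h1 ((ZMod.natCast_eq_zero_iff a p).1 h)
  have hx0 : (1 - k : ZMod p) ≠ 0 := by
    intro h
    refine hcast (k - 1) (by omega) (by omega) ?_
    rw [Nat.cast_sub (by omega), ← neg_eq_zero]
    simpa using h
  have hpow := ZMod.pow_card_sub_one_eq_one hx0
  refine ⟨?_, orderOf_le_of_pow_eq_one (by omega) hpow⟩
  have hpos : 0 < orderOf (1 - k : ZMod p) :=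
    (isOfFinOrder_iff_pow_eq_one.2 ⟨p - 1, by omega, hpow⟩).orderOf_pos
  have hne : orderOf (1 - k : ZMod p) ≠ 1 := by
    rw [Ne, orderOf_eq_one_iff]
    intro h
    exact hcast k (by omega) hkp (by simpa using h)
  omega

/-- For a suitable modulus, a `k`-graph defined by sums contains no zycle of length `ℓ`. -/
theorem exists_modulus_not_hasCopy_zycle {k ℓ : ℕ} (hk : 3 ≤ k) (hℓ : 2 ≤ ℓ) :
    ∃ m : ℕ, m ≠ 0 ∧ m ≤ (k - 1) ^ ℓ + 1 ∧ ∀ n, ¬ HasCopy (zycle k ℓ) (sumEdges k m n) := by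
  set z : ℤ := (1 - k : ℤ) ^ ℓ - 1 with hz
  have habs : ((1 - k : ℤ) ^ ℓ).natAbs = (k - 1) ^ ℓ := by
    rw [Int.natAbs_pow]
    congr 1
    omega
  have hbig : 1 < (k - 1) ^ ℓ := Nat.one_lt_pow (by omega) (by omega)
  have hz0 : z ≠ 0 := by omega
  refine ⟨z.natAbs, by omega, by omega, fun n h => ?_⟩
  have hdvd := hasCopy_zycle_sumEdges (by omega) hℓ (Int.natAbs_dvd.2 dvd_rfl) h
  rw [Int.natAbs_dvd, ← geom_sum_mul] at hdvd
  have hgeom := geom_sum_mul (1 - k : ℤ) ℓ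
  have hS : ∑ i ∈ Finset.range ℓ, (1 - k : ℤ) ^ i ≠ 0 := by
    intro h0
    rw [h0, zero_mul] at hgeom
    exact hz0 hgeom.symm
  have hunit : (1 - k - 1 : ℤ) ∣ 1 := by
    rw [← mul_dvd_mul_iff_left hS, mul_one]
    exact hdvd
  have := Int.le_of_dvd one_pos ((neg_dvd (a := (1 - k - 1 : ℤ))).2 hunit)
  omega

/-- Let `k ≥ 3` be an integer and `p > k` a prime. Then there exists an integer
`ℓ` with `2 ≤ ℓ ≤ p−1` such that `F̃_p^{(k)}` contains a copy of the zycle `Z_ℓ^{(k)}`.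
Consequently, `γ(F̃_p^{(k)}) ≥ 1/(2(k−1)^p) > 0`. -/
theorem statement18 (k p : ℕ) (hk : 3 ≤ k) (hp : p.Prime) (hkp : k < p) :
    (∃ ℓ : ℕ, 2 ≤ ℓ ∧ ℓ ≤ p - 1 ∧ HasCopy (zycle k ℓ) (ftildeEdges k p)) ∧
    (1 : ℝ) / (2 * ((k : ℝ) - 1) ^ p) ≤ codegTuranDensity k (ftildeEdges k p) ∧
    0 < codegTuranDensity k (ftildeEdges k p) := by
  have : Fact p.Prime := ⟨hp⟩
  obtain ⟨hℓ, hℓp⟩ := two_le_orderOf_one_sub (k := k) (p := p) (by omega) hkp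
  have hcopy := hasCopy_zycle_ftildeEdges (k := k) (p := p) (by omega) hℓ
  set ℓ := orderOf (1 - k : ZMod p)
  obtain ⟨m, hm0, hm, hfree⟩ := exists_modulus_not_hasCopy_zycle hk hℓ
  have : NeZero m := ⟨hm0⟩
  have hmlt : m < 2 * (k - 1) ^ p := by
    have h1 : (k - 1) ^ ℓ < (k - 1) ^ p := Nat.pow_lt_pow_right (by omega) (by omega)
    omega
  have hk1 : ((k - 1 : ℕ) : ℝ) = (k : ℝ) - 1 := by
    rw [Nat.cast_sub (by omega), Nat.cast_one]
  have hmlt' : (m : ℝ) < 2 * ((k : ℝ) - 1) ^ p := by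
    rw [← hk1]
    exact_mod_cast hmlt
  have hmpos : (0 : ℝ) < m := Nat.cast_pos.2 (NeZero.pos m)
  have hle : (1 : ℝ) / (2 * ((k : ℝ) - 1) ^ p) ≤ codegTuranDensity k (ftildeEdges k p) :=
    le_codegTuranDensity (by omega) (fun n h => hfree n (hcopy.trans h))
      (one_div_lt_one_div_of_lt hmpos hmlt')
  exact ⟨⟨ℓ, hℓ, hℓp, hcopy⟩, hle, (one_div_pos.2 (hmpos.trans hmlt')).trans_le hle⟩
end

section
/- Let k ≥ 3 and ℓ ≥ 3 be integers, and let P_ℓ^{(k)} be the k-uniform hypergraph defined as follows: its vertices are ℓ pairwise disjoint (k−1)-sets e_1, …, e_ℓ, and its edges are all k-sets e_i ∪ {v} with v ∈ e_{i+1} for 1 ≤ i ≤ ℓ−1 (i.e., e_1 ▷ e_2 ▷ ⋯ ▷ e_ℓ), together with one additional edge e_ℓ ∪ {v_0} for a fixed vertex v_0 ∈ e_1. Then γ(P_ℓ^{(k)}) = 0; equivalently, for every ε > 0 there exists n_0 such that every k-uniform hypergraph H on n ≥ n_0 vertices with minimum codegree δ(H) ≥ εn contains a copy of P_ℓ^{(k)}.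 -/
open Finset

open scoped Classical

/-- The `k`-uniform hypergraph `P_ℓ^{(k)}`: its vertices form `ℓ` pairwise disjoint `(k−1)`-sets
`e_1, …, e_ℓ` (here `e_i = {i} × Fin (k−1)` with `i : Fin ℓ`); its edges are all `k`-sets
`e_i ∪ {v}` with `v ∈ e_{i+1}` for `1 ≤ i ≤ ℓ−1` (i.e. `e_1 ▷ e_2 ▷ ⋯ ▷ e_ℓ`), together with
one additional edge `e_ℓ ∪ {v₀}` for the fixed vertex `v₀ = (0, 0) ∈ e_1`. -/
def pathZ (k ℓ : ℕ) (hk : 2 ≤ k) (hℓ : 1 ≤ ℓ) : Finset (Finset (Fin ℓ × Fin (k - 1))) :=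
  (Finset.univ.image fun p : Fin (ℓ - 1) × Fin (k - 1) =>
    insert ((⟨p.1.val + 1, by have := p.1.isLt; omega⟩ : Fin ℓ), p.2)
      (Finset.univ.image fun j : Fin (k - 1) =>
        ((⟨p.1.val, by have := p.1.isLt; omega⟩ : Fin ℓ), j))) ∪
  {insert ((⟨0, hℓ⟩ : Fin ℓ), (⟨0, by omega⟩ : Fin (k - 1)))
    (Finset.univ.image fun j : Fin (k - 1) => ((⟨ℓ - 1, by omega⟩ : Fin ℓ), j))}

/-- Ramsey's theorem for `q`-uniform hypergraphs with finitely many colours. -/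
theorem exists_ramsey {κ : Type} [Fintype κ] (q : ℕ) :
    ∀ m : κ → ℕ, ∃ R : ℕ, ∀ {α : Type} (S : Finset α) (c : Finset α → κ), R ≤ S.card →
      ∃ i, ∃ B ⊆ S, B.card = m i ∧ ∀ f ⊆ B, f.card = q → c f = i := by
  induction q with
  | zero =>
    intro m
    refine ⟨∑ i, m i, fun S c hS => ⟨c ∅, ?_⟩⟩
    obtain ⟨B, hBS, hB⟩ := Finset.exists_subset_card_eq
      ((Finset.single_le_sum (fun i _ => Nat.zero_le (m i)) (Finset.mem_univ (c ∅))).trans hS)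
    exact ⟨B, hBS, hB, fun f _ hf => by rw [Finset.card_eq_zero.mp hf]⟩
  | succ q ih =>
    intro m
    induction hs : ∑ i, m i using Nat.strong_induction_on generalizing m with
    | _ s ihs =>
    by_cases h0 : ∃ i, m i = 0
    · obtain ⟨i, hi⟩ := h0
      refine ⟨0, fun S c _ => ⟨i, ∅, by simp, by simp [hi], fun f hf hc => ?_⟩⟩
      rw [Finset.subset_empty.mp hf] at hc
      simp at hc
    · push Not at h0
      have hlt : ∀ i, ∑ j, Function.update m i (m i - 1) j < s := by
        intro i
        rw [← hs]
        refine Finset.sum_lt_sum (fun j _ => ?_) ⟨i, Finset.mem_univ _, ?_⟩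
        · by_cases h : j = i
          · subst h; simp
          · simp [h]
        · have := h0 i
          simp; omega
      choose R hR using fun i => ihs _ (hlt i) (Function.update m i (m i - 1)) rfl
      obtain ⟨R', hR'⟩ := ih R
      refine ⟨R' + 1, fun {α} S c hS => ?_⟩
      obtain ⟨v, hv⟩ : S.Nonempty := Finset.card_pos.mp (by omega)
      obtain ⟨i, T, hTS, hT, hTc⟩ := hR' (S.erase v) (fun f => c (insert v f)) (by
        rw [Finset.card_erase_of_mem hv]; omega)
      obtain ⟨j, B, hBT, hB, hBc⟩ := hR i T c hT.ge
      have hBS : B ⊆ S := fun x hx => Finset.mem_of_mem_erase (hTS (hBT hx))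
      have hvB : v ∉ B := fun hx => Finset.notMem_erase v S (hTS (hBT hx))
      by_cases hji : j = i
      · subst hji
        refine ⟨j, insert v B, Finset.insert_subset hv hBS, ?_, fun f hf hfc => ?_⟩
        · rw [Finset.card_insert_of_notMem hvB, hB]
          have := h0 j
          simp; omega
        · by_cases hvf : v ∈ f
          · rw [← Finset.insert_erase hvf]
            refine hTc _ (fun x hx => hBT ?_) (by rw [Finset.card_erase_of_mem hvf]; omega)
            exact Finset.mem_of_mem_insert_of_ne (hf (Finset.mem_of_mem_erase hx))
              (Finset.ne_of_mem_erase hx)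
          · exact hBc f ((Finset.subset_insert_iff_of_notMem hvf).mp hf) hfc
      · exact ⟨j, B, hBS, by simpa [hji] using hB, hBc⟩

/-- Every set contains a subset `W'` on which `D` drops by at most `τ` when passing to a subset
of relative size at least `b`. -/
theorem exists_stable_subset {V : Type} (D : Finset V → Finset V) {b τ : ℝ} (hb : 0 < b)
    (hb1 : b ≤ 1) (hτ : 0 ≤ τ) (T : ℕ) : ∀ W : Finset V, ((D W).card : ℝ) ≤ T * τ →
      ∃ W' ⊆ W, b ^ T * W.card ≤ W'.card ∧
        ∀ W'' ⊆ W', b * W'.card ≤ W''.card → ((D W').card : ℝ) ≤ (D W'').card + τ := by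
  induction T with
  | zero =>
    intro W hW
    refine ⟨W, subset_rfl, by simp, fun W'' _ _ => hW.trans ?_⟩
    simp only [Nat.cast_zero, zero_mul]
    positivity
  | succ T ih =>
    intro W hW
    by_cases hst : ∀ W'' ⊆ W, b * W.card ≤ W''.card → ((D W).card : ℝ) ≤ (D W'').card + τ
    · exact ⟨W, subset_rfl, mul_le_of_le_one_left (by positivity) (pow_le_one₀ hb.le hb1), hst⟩
    · push Not at hst
      obtain ⟨W₁, hW₁, hc, hD⟩ := hst
      push_cast at hW
      obtain ⟨W', hW', hc', hs⟩ := ih W₁ (by linarith)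
      refine ⟨W', hW'.trans hW₁, le_trans ?_ hc', hs⟩
      rw [pow_succ, mul_assoc]
      gcongr

/-- A maximal disjoint family of sets with property `P`. -/
theorem exists_maximal_disjoint_family {V : Type} [Fintype V] (P : Finset V → Prop) :
    ∃ 𝒲 : Finset (Finset V), (∀ W ∈ 𝒲, P W) ∧ (𝒲 : Set (Finset V)).PairwiseDisjoint id ∧
      ∀ W, P W → W.Nonempty → ∃ W' ∈ 𝒲, ¬ Disjoint W W' := by
  obtain ⟨𝒲, h𝒲, hmax⟩ := Finset.exists_max_image
    (Finset.univ.filter fun 𝒲 : Finset (Finset V) =>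
      (∀ W ∈ 𝒲, P W) ∧ (𝒲 : Set (Finset V)).PairwiseDisjoint id) Finset.card
    ⟨∅, by simp⟩
  simp only [Finset.mem_filter, Finset.mem_univ, true_and] at h𝒲 hmax
  refine ⟨𝒲, h𝒲.1, h𝒲.2, fun W hW hne => ?_⟩
  by_contra! hcon
  have hnot : W ∉ 𝒲 := fun h => hne.ne_empty (disjoint_self.mp (hcon W h))
  have := hmax (insert W 𝒲) ⟨by
    simpa [hW] using h𝒲.1, by
    rw [Finset.coe_insert]
    exact h𝒲.2.insert fun W' hW' _ => hcon W' hW'⟩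
  rw [Finset.card_insert_of_notMem hnot] at this
  omega

/-- If `D` is almost constant on each of the sets `X f`, relative to `Y`, these images meet. -/
theorem exists_mem_of_card_sdiff {V ι : Type} (s : Finset ι) (Y : Finset V) (X : ι → Finset V)
    {τ : ℝ} (hXY : ∀ i ∈ s, X i ⊆ Y) (h : ∀ i ∈ s, (Y.card : ℝ) ≤ (X i).card + τ)
    (hY : s.card * τ < Y.card) : ∃ d, ∀ i ∈ s, d ∈ X i := by
  by_contra! hcon
  have hsub : Y ⊆ s.biUnion fun i => Y \ X i := by
    intro d hd
    obtain ⟨i, hi, hdi⟩ := hcon d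
    exact Finset.mem_biUnion.mpr ⟨i, hi, Finset.mem_sdiff.mpr ⟨hd, hdi⟩⟩
  have h1 : (Y.card : ℝ) ≤ ∑ i ∈ s, ((Y \ X i).card : ℝ) := by
    exact_mod_cast (Finset.card_le_card hsub).trans Finset.card_biUnion_le
  have h2 : ∑ i ∈ s, ((Y \ X i).card : ℝ) ≤ ∑ _i ∈ s, τ := by
    refine Finset.sum_le_sum fun i hi => ?_
    have := h i hi
    rw [Finset.cast_card_sdiff (hXY i hi)]
    linarith
  rw [Finset.sum_const, nsmul_eq_mul] at h2
  linarith

/-- The set of vertices completing `s` to an edge of `E`. -/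
noncomputable def nbr {V : Type} [Fintype V] [DecidableEq V] (E : Finset (Finset V))
    (s : Finset V) : Finset V :=
  Finset.univ.filter fun v => insert v s ∈ E

theorem mem_nbr {V : Type} [Fintype V] [DecidableEq V] {E : Finset (Finset V)} {s : Finset V}
    {v : V} : v ∈ nbr E s ↔ insert v s ∈ E := by
  simp [nbr]

theorem hdeg_le_card_nbr {V : Type} [Fintype V] [DecidableEq V] {E : Finset (Finset V)} {k : ℕ}
    (hE : ∀ e ∈ E, e.card = k) (hk : 1 ≤ k) {s : Finset V} (hs : s.card = k - 1) :
    hdeg E s ≤ (nbr E s).card := by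
  refine le_trans (Finset.card_le_card (t := (nbr E s).image fun v => insert v s) ?_)
    Finset.card_image_le
  intro e he
  rw [Finset.mem_filter] at he
  obtain ⟨v, hv⟩ : ∃ v, v ∈ e \ s := by
    refine Finset.card_pos.mp ?_
    rw [Finset.card_sdiff_of_subset he.2, hE e he.1]
    omega
  rw [Finset.mem_sdiff] at hv
  have heq : insert v s = e := by
    refine Finset.eq_of_subset_of_card_le (Finset.insert_subset hv.1 he.2) ?_
    rw [hE e he.1, Finset.card_insert_of_notMem hv.2]
    omega
  exact Finset.mem_image.mpr ⟨v, mem_nbr.mpr (heq ▸ he.1), heq⟩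

/-- `g 0 ▷ g 1 ▷ ⋯ ▷ g (j - 1)` are pairwise disjoint `q`-sets. -/
def IsTriPath {V : Type} [DecidableEq V] (E : Finset (Finset V)) (q : ℕ) (g : ℕ → Finset V)
    (j : ℕ) : Prop :=
  (∀ i < j, (g i).card = q) ∧ (∀ i < j, ∀ i' < j, i ≠ i' → Disjoint (g i) (g i')) ∧
    ∀ i, i + 1 < j → Tri E (g i) (g (i + 1))

theorem exists_fin_enum {V : Type} [DecidableEq V] {q : ℕ} (hq : 0 < q) {s : Finset V}
    (hs : s.card = q) (v : V) :
    ∃ φ : Fin q → V, Function.Injective φ ∧ Finset.univ.image φ = s ∧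
      (v ∈ s → φ ⟨0, hq⟩ = v) := by
  let ψ := (s.equivFinOfCardEq hs).symm
  have key : ∀ χ : Fin q ≃ s, Function.Injective (fun j => (χ j : V)) ∧
      Finset.univ.image (fun j => (χ j : V)) = s := by
    intro χ
    refine ⟨Subtype.val_injective.comp χ.injective, ?_⟩
    ext x
    simp only [Finset.mem_image, Finset.mem_univ, true_and]
    exact ⟨fun ⟨j, hj⟩ => hj ▸ (χ j).2, fun hx => ⟨χ.symm ⟨x, hx⟩, by simp⟩⟩
  by_cases hv : v ∈ s
  · let χ := (Equiv.swap ⟨0, hq⟩ (ψ.symm ⟨v, hv⟩)).trans ψ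
    exact ⟨fun j => χ j, (key χ).1, (key χ).2, fun _ => by simp [χ]⟩
  · exact ⟨fun j => ψ j, (key ψ).1, (key ψ).2, fun h => absurd h hv⟩

theorem hasCopy_pathZ_of_isTriPath {V : Type} [DecidableEq V] {E : Finset (Finset V)} {k ℓ : ℕ}
    (hk : 2 ≤ k) (hℓ : 1 ≤ ℓ) {e : ℕ → Finset V} (he : IsTriPath E (k - 1) e ℓ) {v : V}
    (hv : v ∈ e 0) (hvE : insert v (e (ℓ - 1)) ∈ E) : HasCopy (pathZ k ℓ hk hℓ) E := by
  obtain ⟨hcard, hdisj, htri⟩ := he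
  choose φ hinj himg hφ using fun i : Fin ℓ =>
    exists_fin_enum (by omega : 0 < k - 1) (hcard i i.2) v
  have hmem : ∀ (i : Fin ℓ) j, φ i j ∈ e i := fun i j => by
    rw [← himg i]; exact Finset.mem_image_of_mem _ (Finset.mem_univ j)
  refine ⟨fun p => φ p.1 p.2, ?_, ?_⟩
  · rintro ⟨i, j⟩ ⟨i', j'⟩ h
    simp only at h
    have hii : i = i' := by
      by_contra hne
      exact Finset.disjoint_left.mp (hdisj i i.2 i' i'.2 (by simpa [Fin.ext_iff] using hne))
        (hmem i j) (h ▸ hmem i' j')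
    subst hii
    rw [hinj i h]
  · have himg' : ∀ i : Fin ℓ, (Finset.univ.image fun j : Fin (k - 1) => (i, j)).image
        (fun p : Fin ℓ × Fin (k - 1) => φ p.1 p.2) = e i := fun i => by
      rw [Finset.image_image, ← himg i]; rfl
    intro a ha
    rw [pathZ, Finset.mem_union, Finset.mem_image, Finset.mem_singleton] at ha
    obtain ⟨⟨i, j⟩, -, rfl⟩ | rfl := ha
    · rw [Finset.image_insert, himg']
      exact htri i (by have := i.2; omega) _ (hmem ⟨i + 1, by have := i.2; omega⟩ j)
    · rw [Finset.image_insert, himg']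
      simpa only [hφ ⟨0, hℓ⟩ hv] using hvE

theorem exists_isTriPath {V : Type} [Fintype V] [DecidableEq V] {E : Finset (Finset V)} {q : ℕ}
    {Q : Finset V} {t : ℕ}
    (hdeg : ∀ s : Finset V, s.card = q → Q.card + (t + 1) * q ≤ (nbr E s).card)
    {s : Finset V} (hs : s.card = q) (hsQ : Disjoint s Q) :
    ∀ j ≤ t, ∃ g : ℕ → Finset V, g 0 = s ∧ IsTriPath E q g (j + 1) ∧
      ∀ i < j + 1, Disjoint (g i) Q := by
  intro j
  induction j with
  | zero =>
    refine fun _ => ⟨fun _ => s, rfl, ⟨fun _ _ => hs, fun i hi i' hi' h => ?_, fun i hi => ?_⟩,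
      fun _ _ => hsQ⟩ <;> omega
  | succ j ih =>
    intro hj
    obtain ⟨g, hg0, ⟨hc, hd, ht⟩, hgQ⟩ := ih (by omega)
    have hU : (Q ∪ (Finset.range (j + 1)).biUnion g).card ≤ Q.card + (j + 1) * q := by
      refine (Finset.card_union_le _ _).trans (Nat.add_le_add_left ?_ _)
      refine (Finset.card_biUnion_le_card_mul _ _ q fun i hi => ?_).trans (by simp)
      exact (hc i (Finset.mem_range.mp hi)).le
    have hge : q ≤ (nbr E (g j) \ (Q ∪ (Finset.range (j + 1)).biUnion g)).card := by
      have h1 := hdeg (g j) (hc j (by omega))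
      have h2 := Finset.le_card_sdiff (Q ∪ (Finset.range (j + 1)).biUnion g) (nbr E (g j))
      have h3 : (j + 2) * q ≤ (t + 1) * q := Nat.mul_le_mul_right _ (by omega)
      have h4 : (j + 2) * q = (j + 1) * q + q := by ring
      omega
    obtain ⟨f, hf, hfc⟩ := Finset.exists_subset_card_eq hge
    have hfg : ∀ i < j + 1, Disjoint f (g i) := fun i hi => by
      refine Finset.disjoint_left.mpr fun x hx hxg => (Finset.mem_sdiff.mp (hf hx)).2 ?_
      exact Finset.mem_union_right _ (Finset.mem_biUnion.mpr ⟨i, Finset.mem_range.mpr hi, hxg⟩)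
    have hfQ : Disjoint f Q := Finset.disjoint_left.mpr fun x hx hxg =>
      (Finset.mem_sdiff.mp (hf hx)).2 (Finset.mem_union_left _ hxg)
    have hup : ∀ i < j + 1, Function.update g (j + 1) f i = g i := fun i hi => by
      rw [Function.update_of_ne (by omega)]
    have hself : Function.update g (j + 1) f (j + 1) = f := Function.update_self ..
    refine ⟨Function.update g (j + 1) f, ?_, ⟨?_, ?_, ?_⟩, ?_⟩
    · rw [hup 0 (by omega), hg0]
    · intro i hi
      obtain h | rfl : i < j + 1 ∨ i = j + 1 := by omega
      · rw [hup i h, hc i h]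
      · rw [hself, hfc]
    · intro i hi i' hi' hne
      obtain h | rfl : i < j + 1 ∨ i = j + 1 := by omega
      · obtain h' | rfl : i' < j + 1 ∨ i' = j + 1 := by omega
        · rw [hup i h, hup i' h']; exact hd i h i' h' hne
        · rw [hup i h, hself]; exact (hfg i h).symm
      · rw [hself, hup i' (by omega)]; exact hfg i' (by omega)
    · intro i hi
      rw [hup i (by omega)]
      obtain h | rfl : i < j ∨ i = j := by omega
      · rw [hup (i + 1) (by omega)]; exact ht i (by omega)
      · rw [hself]
        exact fun x hx => mem_nbr.mp (Finset.mem_sdiff.mp (hf hx)).1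
    · intro i hi
      obtain h | rfl : i < j + 1 ∨ i = j + 1 := by omega
      · rw [hup i h]; exact hgQ i h
      · rw [hself]; exact hfQ

/-- The vertices outside `M` completing the last set of a path of `t + 1` sets, all outside `M`
and the first one inside `W`, to an edge. -/
noncomputable def reach {V : Type} [Fintype V] [DecidableEq V] (E : Finset (Finset V)) (q t : ℕ)
    (M W : Finset V) : Finset V :=
  Finset.univ.filter fun d => d ∉ M ∧ ∃ g : ℕ → Finset V, IsTriPath E q g (t + 1) ∧ g 0 ⊆ W ∧
    (∀ i < t + 1, Disjoint (g i) M ∧ d ∉ g i) ∧ insert d (g t) ∈ E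

theorem mem_reach {V : Type} [Fintype V] [DecidableEq V] {E : Finset (Finset V)} {q t : ℕ}
    {M W : Finset V} {d : V} :
    d ∈ reach E q t M W ↔ d ∉ M ∧ ∃ g : ℕ → Finset V, IsTriPath E q g (t + 1) ∧ g 0 ⊆ W ∧
      (∀ i < t + 1, Disjoint (g i) M ∧ d ∉ g i) ∧ insert d (g t) ∈ E := by
  simp [reach]

theorem reach_mono {V : Type} [Fintype V] [DecidableEq V] {E : Finset (Finset V)} {q t : ℕ}
    {M W W' : Finset V} (h : W ⊆ W') : reach E q t M W ⊆ reach E q t M W' := by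
  intro d hd
  rw [mem_reach] at hd ⊢
  obtain ⟨hdM, g, hg, hgW, hrest⟩ := hd
  exact ⟨hdM, g, hg, hgW.trans h, hrest⟩

theorem le_card_reach {V : Type} [Fintype V] [DecidableEq V] {E : Finset (Finset V)} {q t a : ℕ}
    {M W : Finset V} (hW : q ≤ W.card) (hWM : Disjoint W M)
    (hdeg : ∀ s : Finset V, s.card = q → a + (M.card + (t + 1) * q) ≤ (nbr E s).card) :
    a ≤ (reach E q t M W).card := by
  obtain ⟨s, hsW, hs⟩ := Finset.exists_subset_card_eq hW
  obtain ⟨g, hg0, hg, hgM⟩ := exists_isTriPath (Q := M) (t := t)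
    (fun s hs => le_trans (by omega) (hdeg s hs)) hs (hWM.mono_left hsW) t le_rfl
  have hU : (M ∪ (Finset.range (t + 1)).biUnion g).card ≤ M.card + (t + 1) * q := by
    refine (Finset.card_union_le _ _).trans (Nat.add_le_add_left ?_ _)
    refine (Finset.card_biUnion_le_card_mul _ _ q fun i hi => ?_).trans (by simp)
    exact (hg.1 i (Finset.mem_range.mp hi)).le
  have h1 := hdeg (g t) (hg.1 t (by omega))
  have h2 := Finset.le_card_sdiff (M ∪ (Finset.range (t + 1)).biUnion g) (nbr E (g t))
  refine le_trans (by omega) (Finset.card_le_card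
    (s := nbr E (g t) \ (M ∪ (Finset.range (t + 1)).biUnion g)) fun d hd => ?_)
  simp only [Finset.mem_sdiff, Finset.mem_union, Finset.mem_biUnion, Finset.mem_range, not_or,
    not_exists, not_and, mem_nbr] at hd
  exact mem_reach.mpr ⟨hd.2.1, g, hg, hg0 ▸ hsW, fun i hi => ⟨hgM i hi, hd.2.2 i hi⟩, hd.1⟩

/-- Boundedly many disjoint subsets of `U`, each stable for `D`, such that every large subset of
`U` fills a positive proportion of one of them. -/
theorem exists_stable_family {V : Type} [Fintype V] [DecidableEq V] (D : Finset V → Finset V)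
    {b τ : ℝ} (hb : 0 < b) (hb1 : b ≤ 1) (hτ : 0 ≤ τ) (T : ℕ)
    (hD : ∀ W : Finset V, ((D W).card : ℝ) ≤ T * τ) (U : Finset V)
    (hV : 0 < Fintype.card V) :
    ∃ 𝒲 : Finset (Finset V),
      (∀ W ∈ 𝒲, W ⊆ U ∧ b ^ (T + 1) * Fintype.card V ≤ W.card ∧
        ∀ W' ⊆ W, b * W.card ≤ W'.card → ((D W).card : ℝ) ≤ (D W').card + τ) ∧
      𝒲.card * b ^ (T + 1) ≤ 1 ∧
      ∀ X ⊆ U, 2 * b * Fintype.card V ≤ X.card → ∃ W ∈ 𝒲, b * W.card ≤ (X ∩ W).card := by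
  obtain ⟨𝒲, hP, hdisj, hmax⟩ := exists_maximal_disjoint_family fun W : Finset V =>
    W ⊆ U ∧ b ^ (T + 1) * Fintype.card V ≤ W.card ∧
      ∀ W' ⊆ W, b * W.card ≤ W'.card → ((D W).card : ℝ) ≤ (D W').card + τ
  have hV' : (0 : ℝ) < Fintype.card V := by exact_mod_cast hV
  have hsum : ∑ W ∈ 𝒲, (W.card : ℝ) ≤ Fintype.card V := by
    have := Finset.card_biUnion hdisj
    simp only [id] at this
    exact_mod_cast this ▸ Finset.card_le_univ _
  refine ⟨𝒲, hP, ?_, fun X hXU hX => ?_⟩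
  · have h1 : ∑ _W ∈ 𝒲, b ^ (T + 1) * Fintype.card V ≤ ∑ W ∈ 𝒲, (W.card : ℝ) :=
      Finset.sum_le_sum fun W hW => (hP W hW).2.1
    rw [Finset.sum_const, nsmul_eq_mul, ← mul_assoc] at h1
    refine le_of_mul_le_mul_right ?_ hV'
    linarith
  · by_contra! hcon
    have hXY : (X.card : ℝ) ≤ (X \ 𝒲.biUnion id).card + ∑ W ∈ 𝒲, ((X ∩ W).card : ℝ) := by
      have h1 : X ⊆ (X \ 𝒲.biUnion id) ∪ 𝒲.biUnion fun W => X ∩ W := by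
        intro x hx
        simp only [Finset.mem_union, Finset.mem_sdiff, Finset.mem_biUnion, id, Finset.mem_inter]
        grind
      have h2 := (Finset.card_le_card h1).trans (Finset.card_union_le _ _)
      exact_mod_cast h2.trans (Nat.add_le_add_left Finset.card_biUnion_le _)
    have hle : ∑ W ∈ 𝒲, ((X ∩ W).card : ℝ) ≤ b * Fintype.card V := by
      refine (Finset.sum_le_sum fun W hW => (hcon W hW).le).trans ?_
      rw [← Finset.mul_sum]
      gcongr
    obtain ⟨W', hW', hc, hst⟩ := exists_stable_subset D hb hb1 hτ T (X \ 𝒲.biUnion id) (hD _)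
    have hc' : b ^ (T + 1) * Fintype.card V ≤ W'.card := by
      refine le_trans ?_ hc
      rw [pow_succ, mul_assoc]
      gcongr
      linarith
    have hne : W'.Nonempty := by
      rw [← Finset.card_pos]
      have : (0 : ℝ) < W'.card := lt_of_lt_of_le (by positivity) hc'
      exact_mod_cast this
    obtain ⟨W, hW, hnd⟩ := hmax W' ⟨(hW'.trans Finset.sdiff_subset).trans hXU, hc', hst⟩ hne
    refine hnd (Finset.disjoint_left.mpr fun x hx hxW => ?_)
    exact (Finset.mem_sdiff.mp (hW' hx)).2 (Finset.mem_biUnion.mpr ⟨W, hW, hxW⟩)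

/-- A `(k - 1)`-set through `d`, otherwise avoiding `Q`, with many neighbours in `B`. -/
theorem exists_card_nbr_inter {V : Type} [Fintype V] [DecidableEq V] {E : Finset (Finset V)}
    {k : ℕ} (hk : 3 ≤ k) {ε : ℝ} {Q B : Finset V} {d : V}
    (hdeg : ∀ s : Finset V, s.card = k - 1 → ε * Fintype.card V ≤ (nbr E s).card)
    (hε : ε ≤ 1) (hdQ : d ∈ Q) (hBQ : B ⊆ Q) (hdB : d ∉ B) (hV : 0 < Fintype.card V)
    (hQ : (Q.card + k : ℝ) ≤ ε / 2 * Fintype.card V) (hB : (k : ℝ) ≤ B.card * (ε / 2)) :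
    ∃ e : Finset V, d ∈ e ∧ e.card = k - 1 ∧ (∀ x ∈ e, x ∈ Q → x = d) ∧
      k - 1 ≤ (nbr E e ∩ B).card := by
  have hV' : (0 : ℝ) < Fintype.card V := by exact_mod_cast hV
  have hQc : k - 3 ≤ Qᶜ.card := by
    rw [Finset.card_compl]
    have : (Q.card + k : ℝ) ≤ Fintype.card V := by nlinarith
    have : Q.card + k ≤ Fintype.card V := by exact_mod_cast this
    omega
  obtain ⟨w, hwQ, hw⟩ := Finset.exists_subset_card_eq hQc
  have hwQ' : ∀ x ∈ w, x ∉ Q := fun x hx => Finset.mem_compl.mp (hwQ hx)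
  have hdw : d ∉ w := fun h => hwQ' d h hdQ
  obtain ⟨x, hxQ, hxw, hx⟩ : ∃ x, x ∉ Q ∧ x ∉ w ∧
      k - 1 ≤ (B.filter fun b => x ∈ nbr E (insert b (insert d w))).card := by
    by_contra! hcon
    have hcount := Finset.sum_card_bipartiteAbove_eq_sum_card_bipartiteBelow
      (s := B) (t := (Q ∪ w)ᶜ) (fun b x => x ∈ nbr E (insert b (insert d w)))
    have hupper : ∑ x ∈ (Q ∪ w)ᶜ, (B.filter fun b => x ∈ nbr E (insert b (insert d w))).card
        ≤ Fintype.card V * (k - 2) := by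
      refine (Finset.sum_le_card_nsmul _ _ (k - 2) fun x hx => ?_).trans ?_
      · rw [Finset.mem_compl, Finset.mem_union, not_or] at hx
        have := hcon x hx.1 hx.2
        omega
      · rw [smul_eq_mul]
        exact Nat.mul_le_mul_right _ (Finset.card_le_univ _)
    have hlower : ∀ b ∈ B, ε / 2 * Fintype.card V ≤
        ((((Q ∪ w)ᶜ).filter fun x => x ∈ nbr E (insert b (insert d w))).card : ℝ) := by
      intro b hb
      have hbw : b ∉ insert d w := by
        rw [Finset.mem_insert, not_or]
        exact ⟨fun h => hdB (h ▸ hb), fun h => hwQ' b h (hBQ hb)⟩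
      have h1 := hdeg (insert b (insert d w)) (by
        rw [Finset.card_insert_of_notMem hbw, Finset.card_insert_of_notMem hdw]; omega)
      have h2 : (nbr E (insert b (insert d w))).card ≤
          ((((Q ∪ w)ᶜ).filter fun x => x ∈ nbr E (insert b (insert d w))).card) +
            (Q.card + k) := by
        have h3 : nbr E (insert b (insert d w)) ⊆
            (((Q ∪ w)ᶜ).filter fun x => x ∈ nbr E (insert b (insert d w))) ∪ (Q ∪ w) := by
          intro y hy
          rw [Finset.mem_union, Finset.mem_filter, Finset.mem_compl]
          tauto
        have h4 := (Finset.card_le_card h3).trans (Finset.card_union_le _ _)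
        have h5 := Finset.card_union_le Q w
        omega
      have h2' : ((nbr E (insert b (insert d w))).card : ℝ) ≤
          ((((Q ∪ w)ᶜ).filter fun x => x ∈ nbr E (insert b (insert d w))).card) +
            (Q.card + k) := by exact_mod_cast h2
      linarith
    have hsum := Finset.sum_le_sum hlower
    rw [Finset.sum_const, nsmul_eq_mul] at hsum
    simp only [Finset.bipartiteAbove, Finset.bipartiteBelow] at hcount
    rw [← hcount] at hupper
    have hupper' : ∑ b ∈ B,
        ((((Q ∪ w)ᶜ).filter fun x => x ∈ nbr E (insert b (insert d w))).card : ℝ) ≤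
          Fintype.card V * ((k - 2 : ℕ) : ℝ) := by exact_mod_cast hupper
    have hk2 : ((k - 2 : ℕ) : ℝ) = k - 2 := by
      rw [Nat.cast_sub (by omega)]; norm_num
    rw [hk2] at hupper'
    have := mul_le_mul_of_nonneg_right hB hV'.le
    nlinarith
  refine ⟨insert x (insert d w), by simp, ?_, ?_, hx.trans (Finset.card_le_card ?_)⟩
  · rw [Finset.card_insert_of_notMem, Finset.card_insert_of_notMem hdw]
    · omega
    · rw [Finset.mem_insert, not_or]
      exact ⟨fun h => hxQ (h ▸ hdQ), hxw⟩
  · intro y hy hyQ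
    rw [Finset.mem_insert, Finset.mem_insert] at hy
    obtain rfl | rfl | hy := hy
    · exact absurd hyQ hxQ
    · rfl
    · exact absurd hyQ (hwQ' y hy)
  · intro b hb
    rw [Finset.mem_filter, mem_nbr, Finset.insert_comm] at hb
    exact Finset.mem_inter.mpr ⟨mem_nbr.mpr hb.2, hb.1⟩

/-- Prepending two sets to a path. -/
theorem IsTriPath.cons_cons {V : Type} [DecidableEq V] {E : Finset (Finset V)} {q j : ℕ}
    {g : ℕ → Finset V} (hg : IsTriPath E q g (j + 1)) {e f : Finset V} (he : e.card = q)
    (hf : f.card = q) (hef : Disjoint e f) (heg : ∀ i < j + 1, Disjoint e (g i))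
    (hfg : ∀ i < j + 1, Disjoint f (g i)) (hte : Tri E e f) (htf : Tri E f (g 0)) :
    IsTriPath E q (fun i => Nat.casesOn i e fun i => Nat.casesOn i f g) (j + 3) := by
  obtain ⟨hc, hd, ht⟩ := hg
  refine ⟨?_, ?_, ?_⟩
  · rintro (_ | _ | i) hi
    · exact he
    · exact hf
    · exact hc i (by omega)
  · rintro (_ | _ | i) hi (_ | _ | i') hi' hne
    · exact absurd rfl hne
    · exact hef
    · exact heg i' (by omega)
    · exact hef.symm
    · exact absurd rfl hne
    · exact hfg i' (by omega)
    · exact (heg i (by omega)).symm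
    · exact (hfg i (by omega)).symm
    · exact hd i (by omega) i' (by omega) (by omega)
  · rintro (_ | _ | i) hi
    · exact hte
    · exact htf
    · exact ht i (by omega)

theorem hasCopy_pathZ_of_mem_reach {V : Type} [Fintype V] [DecidableEq V] {E : Finset (Finset V)}
    {k t : ℕ} (hk : 3 ≤ k) {ε : ℝ} {M B : Finset V} {d : V}
    (hdeg : ∀ s : Finset V, s.card = k - 1 → ε * Fintype.card V ≤ (nbr E s).card)
    (hε : ε ≤ 1) (hBM : B ⊆ M) (hdM : d ∉ M) (hV : 0 < Fintype.card V)
    (hB : (k : ℝ) ≤ B.card * (ε / 2))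
    (hM : ((M.card + 1 + B.card.choose (k - 1) * ((t + 1) * (k - 1)) + k : ℕ) : ℝ) ≤
      ε / 2 * Fintype.card V)
    (hreach : ∀ f ∈ B.powersetCard (k - 1), d ∈ reach E (k - 1) t M (nbr E f)) :
    HasCopy (pathZ k (t + 3) (Nat.le_of_succ_le hk) (Nat.le_add_left 1 (t + 2))) E := by
  simp only [mem_reach] at hreach
  choose hdM' g hg hg0 hgM hgE using hreach
  let Q : Finset V := insert d M ∪ (B.powersetCard (k - 1)).attach.biUnion fun f =>
    (Finset.range (t + 1)).biUnion (g f.1 f.2)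
  have hQ : Q.card ≤ M.card + 1 + B.card.choose (k - 1) * ((t + 1) * (k - 1)) := by
    refine (Finset.card_union_le _ _).trans (Nat.add_le_add (Finset.card_insert_le _ _) ?_)
    refine (Finset.card_biUnion_le_card_mul _ _ ((t + 1) * (k - 1)) fun f _ => ?_).trans
      (by simp)
    refine (Finset.card_biUnion_le_card_mul _ _ (k - 1) fun i hi => ?_).trans (by simp)
    exact ((hg f.1 f.2).1 i (Finset.mem_range.mp hi)).le
  have hMQ : insert d M ⊆ Q := Finset.subset_union_left
  have hgQ : ∀ f hf, ∀ i < t + 1, g f hf i ⊆ Q := fun f hf i hi x hx =>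
    Finset.mem_union_right _ (Finset.mem_biUnion.mpr ⟨⟨f, hf⟩, Finset.mem_attach _ _,
      Finset.mem_biUnion.mpr ⟨i, Finset.mem_range.mpr hi, hx⟩⟩)
  obtain ⟨e, hde, hec, heQ, heB⟩ := exists_card_nbr_inter hk (Q := Q) (B := B) (d := d) hdeg hε
    (hMQ (Finset.mem_insert_self _ _))
    (hBM.trans ((Finset.subset_insert _ _).trans hMQ)) (fun h => hdM (hBM h)) hV
    (le_trans (by exact_mod_cast Nat.add_le_add_right hQ k) hM) hB
  obtain ⟨f, hfB, hfc⟩ := Finset.exists_subset_card_eq heB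
  have hf : f ∈ B.powersetCard (k - 1) :=
    Finset.mem_powersetCard.mpr ⟨hfB.trans Finset.inter_subset_right, hfc⟩
  have hfM : f ⊆ M := (Finset.mem_powersetCard.mp hf).1.trans hBM
  refine hasCopy_pathZ_of_isTriPath (by omega) (by omega)
    ((hg f hf).cons_cons hec hfc ?_ ?_ ?_ ?_ ?_) hde (hgE f hf)
  · refine Finset.disjoint_left.mpr fun x hx hxf => hdM ?_
    rw [← heQ x hx (hMQ (Finset.mem_insert_of_mem (hfM hxf)))]
    exact hfM hxf
  · refine fun i hi => Finset.disjoint_left.mpr fun x hx hxg => (hgM f hf i hi).2 ?_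
    rw [← heQ x hx (hgQ f hf i hi hxg)]
    exact hxg
  · exact fun i hi => ((hgM f hf i hi).1.mono_right hfM).symm
  · exact fun x hx => mem_nbr.mp (Finset.mem_inter.mp (hfB hx)).1
  · exact fun x hx => mem_nbr.mp (hg0 f hf hx)

theorem hasCopy_pathZ_of_codegree {k t : ℕ} (hk : 3 ≤ k) {ε : ℝ} (hε : 0 < ε) (hε1 : ε ≤ 1) :
    ∃ n₀ : ℕ, ∀ n ≥ n₀, ∀ E : Finset (Finset (Fin n)),
      (∀ s : Finset (Fin n), s.card = k - 1 → ε * n ≤ ((nbr E s).card : ℝ)) →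
      HasCopy (pathZ k (t + 3) (Nat.le_of_succ_le hk) (Nat.le_add_left 1 (t + 2))) E := by
  obtain ⟨r, hr⟩ := exists_nat_ge (k / (ε / 2))
  rw [div_le_iff₀ (by positivity)] at hr
  let S := r.choose (k - 1)
  let σ : ℝ := ε / (4 * (S + 1))
  have hσ : 0 < σ := by positivity
  have hSσ : S * σ < ε / 2 := by
    have : σ * (4 * (S + 1)) = ε := div_mul_cancel₀ _ (by positivity)
    nlinarith
  obtain ⟨T, hT⟩ := exists_nat_ge (1 / σ)
  rw [div_le_iff₀ hσ] at hT
  let b : ℝ := ε / 4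
  have hb : 0 < b := by positivity
  have hb1 : b ≤ 1 := by simp only [b]; linarith
  let δ : ℝ := b ^ (T + 1)
  have hδ : 0 < δ := by positivity
  have hδb : δ ≤ b := pow_le_of_le_one hb.le hb1 (by omega)
  obtain ⟨p, hp⟩ := exists_nat_ge (1 / δ)
  rw [div_le_iff₀ hδ] at hp
  obtain ⟨R, hR⟩ := exists_ramsey (κ := Fin (p + 1)) (k - 1) fun _ => r
  let C : ℕ := R + 1 + S * ((t + 1) * (k - 1)) + k + (t + 1) * (k - 1) + 1
  obtain ⟨n₀, hn₀⟩ := exists_nat_ge (C / δ)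
  rw [div_le_iff₀ hδ] at hn₀
  refine ⟨n₀, fun n hn E hdeg => ?_⟩
  have hCn : (C : ℝ) ≤ δ * n := by
    have : (n₀ : ℝ) ≤ n := by exact_mod_cast hn
    nlinarith
  have hCb : (C : ℝ) ≤ ε / 4 * n := hCn.trans (by gcongr)
  have hCpos : (0 : ℝ) < C := by positivity
  have hn0 : (0 : ℝ) < n := by
    by_contra h
    nlinarith
  have hCnat : C ≤ n := by
    have : (C : ℝ) ≤ n := hCb.trans (mul_le_of_le_one_left hn0.le hb1)
    exact_mod_cast this
  have hcard : Fintype.card (Fin n) = n := Fintype.card_fin n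
  obtain ⟨M, -, hM⟩ := Finset.exists_subset_card_eq
    (s := (Finset.univ : Finset (Fin n))) (n := R) (by simp; omega)
  obtain ⟨𝒲, h𝒲, h𝒲p, h𝒲X⟩ := exists_stable_family (reach E (k - 1) t M) hb hb1
    (τ := σ * n) (by positivity) T (fun W => by
      have h1 : ((reach E (k - 1) t M W).card : ℝ) ≤ n := by
        exact_mod_cast (Finset.card_le_univ _).trans hcard.le
      nlinarith) Mᶜ (by rw [hcard]; exact_mod_cast hn0)
  rw [hcard] at h𝒲X
  simp only [hcard] at h𝒲
  have h𝒲le : 𝒲.card ≤ p := by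
    have : (𝒲.card : ℝ) ≤ p := le_of_mul_le_mul_right (h𝒲p.trans hp) hδ
    exact_mod_cast this
  have hcol : ∀ f : Finset (Fin n), ∃ W, f.card = k - 1 →
      W ∈ 𝒲 ∧ b * W.card ≤ ((nbr E f \ M ∩ W).card : ℝ) := by
    intro f
    by_cases hf : f.card = k - 1
    · obtain ⟨W, hW, h⟩ := h𝒲X (nbr E f \ M) (fun x hx => by
        rw [Finset.mem_compl]; exact (Finset.mem_sdiff.mp hx).2) (by
        have h1 : (nbr E f).card ≤ (nbr E f \ M).card + R := by
          have := Finset.le_card_sdiff M (nbr E f)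
          omega
        have h1' : ((nbr E f).card : ℝ) ≤ (nbr E f \ M).card + R := by exact_mod_cast h1
        have h2 : (R : ℝ) ≤ C := by exact_mod_cast (by omega : R ≤ C)
        have h3 := hdeg f hf
        simp only [b]
        linarith)
      exact ⟨W, fun _ => ⟨hW, h⟩⟩
    · exact ⟨∅, fun h => absurd h hf⟩
  choose col hcol using hcol
  obtain ⟨code, hcode⟩ : ∃ code : Finset (Fin n) → Fin (p + 1), Set.InjOn code 𝒲 := by
    refine ⟨fun W => if h : W ∈ 𝒲 then Fin.castLE (by omega) (𝒲.equivFin ⟨W, h⟩) else 0, ?_⟩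
    intro W hW W' hW' h
    rw [Finset.mem_coe] at hW hW'
    simpa [hW, hW'] using h
  obtain ⟨i, B, hBM, hBr, hBi⟩ := hR M (fun f => code (col f)) hM.ge
  have hBk : k - 1 ≤ B.card := by
    have : (k : ℝ) ≤ r := by nlinarith [(Nat.cast_nonneg r : (0 : ℝ) ≤ r)]
    have : k ≤ r := by exact_mod_cast this
    omega
  obtain ⟨f₀, hf₀B, hf₀⟩ := Finset.exists_subset_card_eq hBk
  obtain ⟨hW, -⟩ := hcol f₀ hf₀
  have hcolW : ∀ f ∈ B.powersetCard (k - 1), col f = col f₀ := fun f hf => by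
    rw [Finset.mem_powersetCard] at hf
    exact hcode (hcol f hf.2).1 hW ((hBi f hf.1 hf.2).trans (hBi f₀ hf₀B hf₀).symm)
  obtain ⟨hWM, hWδ, hWst⟩ := h𝒲 _ hW
  obtain ⟨a, ha⟩ : ∃ a : ℕ, a = ⌈ε / 2 * n⌉₊ := ⟨_, rfl⟩
  have haε : ε / 2 * n ≤ a := ha ▸ Nat.le_ceil _
  have hWreach : a ≤ (reach E (k - 1) t M (col f₀)).card := by
    refine le_card_reach ?_ ?_ fun s hs => ?_
    · have h1 : (C : ℝ) ≤ (col f₀).card := hCn.trans hWδ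
      have h2 : C ≤ (col f₀).card := by exact_mod_cast h1
      omega
    · exact Finset.disjoint_left.mpr fun x hx => Finset.mem_compl.mp (hWM hx)
    · have h1 : (a : ℝ) < ε / 2 * n + 1 := ha ▸ Nat.ceil_lt_add_one (by positivity)
      have h2 : ((M.card + (t + 1) * (k - 1) + 1 : ℕ) : ℝ) ≤ C := by
        exact_mod_cast (by omega : M.card + (t + 1) * (k - 1) + 1 ≤ C)
      have h3 := hdeg s hs
      have h4 : ((a + (M.card + (t + 1) * (k - 1)) : ℕ) : ℝ) ≤ (nbr E s).card := by
        push_cast at h2 ⊢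
        nlinarith
      exact_mod_cast h4
  obtain ⟨d, hd⟩ := exists_mem_of_card_sdiff (B.powersetCard (k - 1))
    (reach E (k - 1) t M (col f₀)) (fun f => reach E (k - 1) t M (nbr E f \ M ∩ col f₀))
    (τ := σ * n) (fun f _ => reach_mono Finset.inter_subset_right)
    (fun f hf => hWst _ Finset.inter_subset_right (by
      rw [← hcolW f hf]; exact (hcol f (Finset.mem_powersetCard.mp hf).2).2))
    (by
      rw [Finset.card_powersetCard, hBr]
      have : (a : ℝ) ≤ (reach E (k - 1) t M (col f₀)).card := by exact_mod_cast hWreach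
      have : S * σ * n < ε / 2 * n := by gcongr
      simp only [S] at this
      linarith)
  have hdM : d ∉ M :=
    (mem_reach.mp (hd f₀ (Finset.mem_powersetCard.mpr ⟨hf₀B, hf₀⟩))).1
  refine hasCopy_pathZ_of_mem_reach hk (ε := ε) (M := M) (B := B) (d := d)
    (by simpa only [hcard] using hdeg) hε1 hBM hdM (by rw [hcard]; exact_mod_cast hn0)
    (by rw [hBr]; exact hr) ?_ fun f hf =>
      reach_mono (Finset.inter_subset_left.trans Finset.sdiff_subset) (hd f hf)
  rw [hcard, hM, hBr]
  have h1 : ((R + 1 + r.choose (k - 1) * ((t + 1) * (k - 1)) + k : ℕ) : ℝ) ≤ C := by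
    exact_mod_cast (by simp only [C, S]; omega)
  nlinarith

theorem exists_hasCopy_pathZ {k ℓ : ℕ} (hk : 3 ≤ k) (hℓ : 3 ≤ ℓ) {ε : ℝ} (hε : 0 < ε) :
    ∃ n₀ : ℕ, ∀ n ≥ n₀, ∀ E : Finset (Finset (Fin n)), (∀ e ∈ E, e.card = k) →
      (∀ s : Finset (Fin n), s.card = k - 1 → ε * n ≤ (hdeg E s : ℝ)) →
      HasCopy (pathZ k ℓ (Nat.le_of_succ_le hk) (Nat.le_of_succ_le (Nat.le_of_succ_le hℓ))) E := by
  obtain ⟨t, rfl⟩ : ∃ t, ℓ = t + 3 := ⟨ℓ - 3, by omega⟩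
  obtain ⟨n₀, h⟩ := hasCopy_pathZ_of_codegree (t := t) hk (lt_min hε one_pos) (min_le_right ε 1)
  refine ⟨n₀, fun n hn E hE hdE => h n hn E fun s hs => ?_⟩
  have h1 : (hdeg E s : ℝ) ≤ (nbr E s).card := by
    exact_mod_cast hdeg_le_card_nbr hE (by omega) hs
  refine le_trans ?_ ((hdE s hs).trans h1)
  gcongr
  exact min_le_left _ _

theorem codegTuranDensity_eq_zero {α : Type*} {k : ℕ} {F : Finset (Finset α)}
    (h : ∀ ε : ℝ, 0 < ε → ∃ n₀ : ℕ, ∀ n ≥ n₀, ∀ E : Finset (Finset (Fin n)),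
      (∀ e ∈ E, e.card = k) →
      (∀ s : Finset (Fin n), s.card = k - 1 → ε * n ≤ (hdeg E s : ℝ)) → HasCopy F E) :
    codegTuranDensity k F = 0 := by
  refine Filter.Tendsto.limsup_eq (Metric.tendsto_atTop.mpr fun ε hε => ?_)
  obtain ⟨n₀, hn₀⟩ := h (ε / 2) (by positivity)
  refine ⟨n₀ + 1, fun n hn => ?_⟩
  have hn0 : (0 : ℝ) < n := by exact_mod_cast (by omega : 0 < n)
  have hle : exco k n F ≤ ⌊ε / 2 * n⌋₊ := by
    refine csSup_le' fun d ⟨E, hE, hfree, hd⟩ => Nat.le_floor ?_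
    by_contra! hlt
    refine hfree (hn₀ n (by omega) E hE fun s hs => hlt.le.trans ?_)
    exact_mod_cast hd s hs
  have hle' : (exco k n F : ℝ) ≤ ε / 2 * n :=
    (Nat.cast_le.mpr hle).trans (Nat.floor_le (by positivity))
  rw [Real.dist_eq, sub_zero, abs_of_nonneg (by positivity), div_lt_iff₀ hn0]
  nlinarith

/-- Let `k ≥ 3` and `ℓ ≥ 3` be integers. Then `γ(P_ℓ^{(k)}) = 0`; equivalently,
for every `ε > 0` there exists `n₀` such that every `k`-uniform hypergraph `H` on `n ≥ n₀`
vertices with minimum codegree `δ(H) ≥ εn` contains a copy of `P_ℓ^{(k)}`. -/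
theorem statement19 (k ℓ : ℕ) (hk : 3 ≤ k) (hℓ : 3 ≤ ℓ) :
    codegTuranDensity k (pathZ k ℓ (by omega) (by omega)) = 0 ∧
    ∀ ε : ℝ, 0 < ε → ∃ n₀ : ℕ, ∀ n ≥ n₀, ∀ E : Finset (Finset (Fin n)),
      (∀ e ∈ E, e.card = k) →
      (∀ s : Finset (Fin n), s.card = k - 1 → ε * n ≤ (hdeg E s : ℝ)) →
      HasCopy (pathZ k ℓ (by omega) (by omega)) E := by
  exact ⟨codegTuranDensity_eq_zero fun ε hε => exists_hasCopy_pathZ hk hℓ hε,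
    fun ε hε => exists_hasCopy_pathZ hk hℓ hε⟩
end
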